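/- Let d ≥ 2 and set d̃ = d+1. Let V = ⊕_{i=1}^d V_i be a graded vector space of forms in R with dimension vector δ = (δ_1,…,δ_d), let σ = max{2, δ_1, …, δ_d}, and let I be the ideal of R generated by V. Then the projective dimension of R/I as an R-module satisfies pd_R(R/I) ≤ d̃ ↑^{d²+d−2} (d̃^σ). -/

import Mathlib

open MvPolynomial

/-- Knuth's up-arrow `knuth a k b = a ↑^k b`, with `a ↑^1 b = a ^ b`,
`a ↑^(k+1) 1 = a` and `a ↑^(k+1) (b+1) = a ↑^k (a ↑^(k+1) b)`. -/
def knuth (a : ℕ) : ℕ → ℕ → ℕ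
  | 0, b => a ^ b
  | 1, b => a ^ b
  | _+2, 0 => 1
  | _+2, 1 => a
  | k+2, b+2 => knuth a (k+1) (knuth a (k+2) (b+1))
  termination_by k b => (k, b)

open CategoryTheory in
/-- The projective dimension of the `R`-module `M` is at most `n`:
there is a projective resolution of `M` vanishing in degrees `> n`. -/
def ProjDimLE (R : Type*) [CommRing R] (M : Type*) [AddCommGroup M] [Module R M]
    (n : ℕ) : Prop :=
  ∃ P : ProjectiveResolution (ModuleCat.of R M),
    ∀ i, n < i → Limits.IsZero (P.complex.X i)

section RegularLocal

open IsLocalRing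

theorem isLocalRing_quotient_span_singleton {S : Type*} [CommRing S] [IsLocalRing S] {z : S}
    (hz : z ∈ maximalIdeal S) : IsLocalRing (S ⧸ Ideal.span {z}) := by
  have hne : Ideal.span {z} ≠ ⊤ := fun h =>
    (maximalIdeal.isMaximal S).ne_top (top_le_iff.mp (h ▸ (Ideal.span_singleton_le_iff_mem _).2 hz))
  have : Nontrivial (S ⧸ Ideal.span {z}) := Ideal.Quotient.nontrivial_iff.mpr hne
  exact .of_surjective' (Ideal.Quotient.mk _) Ideal.Quotient.mk_surjective

open Classical in
theorem spanFinrank_maximalIdeal_quotient_succ_le {S : Type*} [CommRing S] [IsLocalRing S]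
    [IsNoetherianRing S] {z : S} (hz : z ∈ maximalIdeal S) (hz2 : z ∉ maximalIdeal S ^ 2)
    [IsLocalRing (S ⧸ Ideal.span {z})] :
    (maximalIdeal (S ⧸ Ideal.span {z})).spanFinrank + 1 ≤ (maximalIdeal S).spanFinrank := by
  set q := Ideal.Quotient.mk (Ideal.span {z})
  have hq : Function.Surjective q := Ideal.Quotient.mk_surjective
  have hmap : maximalIdeal (S ⧸ Ideal.span {z}) = (maximalIdeal S).map q := by
    have hc : (maximalIdeal (S ⧸ Ideal.span {z})).comap q = maximalIdeal S :=
      eq_maximalIdeal (Ideal.comap_isMaximal_of_surjective q hq)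
    rw [← hc, Ideal.map_comap_of_surjective q hq]
  set w : CotangentSpace S := (maximalIdeal S).toCotangent ⟨z, hz⟩
  have hw : w ≠ 0 := fun h => hz2 (((maximalIdeal S).toCotangent_eq_zero ⟨z, hz⟩).1 h)
  have hli : LinearIndepOn (ResidueField S) id ({w} : Set (CotangentSpace S)) :=
    LinearIndepOn.singleton hw
  let b := Module.Basis.extend hli
  have hws : w ∈ hli.extend (Set.subset_univ _) := hli.subset_extend _ rfl
  set s := hli.extend (Set.subset_univ _)
  have : Finite s := Module.Finite.finite_basis b
  have hcard : s.ncard = (maximalIdeal S).spanFinrank := by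
    rw [spanFinrank_maximalIdeal_eq_finrank_cotangentSpace, Module.finrank_eq_nat_card_basis b]
    rfl
  obtain ⟨g, hg⟩ := (maximalIdeal S).toCotangent_surjective.hasRightInverse
  let g' : CotangentSpace S → maximalIdeal S := Function.update g w ⟨z, hz⟩
  have hg' : ∀ v, (maximalIdeal S).toCotangent (g' v) = v := by
    intro v
    by_cases h : v = w
    · subst h; simp [g']; rfl
    · simp [g', h, hg v]
  have hspan : Submodule.span S (g' '' s) = ⊤ := by
    rw [← CotangentSpace.span_image_eq_top_iff, ← Set.image_comp]
    have : (⇑(maximalIdeal S).toCotangent ∘ g') '' s = s := by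
      ext v; simp [hg']
    rw [this]
    have hb : Submodule.span (ResidueField S) (Set.range (Module.Basis.extend hli)) = ⊤ :=
      Module.Basis.span_eq _
    rwa [Module.Basis.range_extend hli] at hb
  have hspan2 : (maximalIdeal S) = Ideal.span ((fun v => (g' v : S)) '' s) := by
    have := congrArg (Submodule.map (maximalIdeal S).subtype) hspan
    rw [Submodule.map_span, Submodule.map_top, Submodule.range_subtype, ← Set.image_comp] at this
    exact this.symm
  have hspan3 : (maximalIdeal (S ⧸ Ideal.span {z})) =
      Ideal.span ((fun v => q (g' v : S)) '' (s \ {w})) := by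
    rw [hmap]
    conv_lhs => rw [hspan2]
    rw [Ideal.map_span, ← Set.image_comp]
    have hs : s = insert w (s \ {w}) := by simp [Set.insert_eq_of_mem hws]
    conv_lhs => rw [hs, Set.image_insert_eq]
    have : (⇑q ∘ fun v ↦ (g' v : S)) w = 0 := by
      simp only [Function.comp, g', Function.update_self]
      exact Ideal.Quotient.eq_zero_iff_mem.2 (Ideal.mem_span_singleton_self z)
    rw [this, Ideal.span_insert_zero]
    rfl
  have hfin : (s \ {w}).Finite := Set.Finite.subset (Set.toFinite s) Set.sdiff_subset
  have h1 : (maximalIdeal (S ⧸ Ideal.span {z})).spanFinrank ≤ (s \ {w}).ncard := by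
    rw [hspan3]
    exact (Submodule.spanFinrank_span_le_ncard_of_finite (hfin.image _)).trans
      (Set.ncard_image_le hfin)
  have h2 := Set.ncard_sdiff_singleton_add_one hws
  omega

theorem isRegularLocalRing_quotient_span_singleton {S : Type*} [CommRing S]
    [IsRegularLocalRing S] {z : S} (hz : z ∈ maximalIdeal S) (hz2 : z ∉ maximalIdeal S ^ 2) :
    ∃ _ : IsRegularLocalRing (S ⧸ Ideal.span {z}),
      (maximalIdeal (S ⧸ Ideal.span {z})).spanFinrank + 1 = (maximalIdeal S).spanFinrank := by
  have := isLocalRing_quotient_span_singleton hz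
  have h1 := spanFinrank_maximalIdeal_quotient_succ_le hz hz2
  have h2 := IsRegularLocalRing.spanFinrank_maximalIdeal (R := S)
  have h3 := ringKrullDim_le_ringKrullDim_quotient_add_card ({z} : Finset S)
    (by simpa [IsLocalRing.ringJacobson_eq_maximalIdeal] using hz)
  rw [Finset.coe_singleton, Finset.card_singleton, Nat.cast_one, ← h2] at h3
  have h4 : (((maximalIdeal (S ⧸ Ideal.span {z})).spanFinrank : ℕ) : WithBot ℕ∞) + 1 ≤
      (maximalIdeal S).spanFinrank := by
    exact_mod_cast (Nat.cast_le (α := WithBot ℕ∞)).2 h1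
  have h5 : IsRegularLocalRing (S ⧸ Ideal.span {z}) := by
    apply IsRegularLocalRing.of_spanFinrank_maximalIdeal_le
    exact ENat.WithBot.add_le_add_one_right_iff.1 (h4.trans h3)
  refine ⟨h5, le_antisymm h1 ?_⟩
  have h6 := IsRegularLocalRing.spanFinrank_maximalIdeal (R := S ⧸ Ideal.span {z})
  rw [← h6] at h3
  exact_mod_cast h3

theorem IsRegularLocalRing.isDomain_aux (n : ℕ) : ∀ (S : Type*) [CommRing S]
    [IsRegularLocalRing S], (maximalIdeal S).spanFinrank = n → IsDomain S := by
  induction n with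
  | zero =>
    intro S _ _ h
    rw [Submodule.spanFinrank_eq_zero_iff_eq_bot (IsNoetherian.noetherian _)] at h
    exact (IsLocalRing.isField_iff_maximalIdeal_eq.2 h).isDomain
  | succ n ih =>
    intro S _ _ h
    have hfin := minimalPrimes.finite_of_isNoetherianRing S
    obtain ⟨z, hz, hz2⟩ : ∃ z ∈ maximalIdeal S,
        z ∉ ⋃ p ∈ insert (maximalIdeal S ^ 2) (minimalPrimes S), (p : Set S) := by
      by_contra! hcon
      obtain ⟨p, hp, hle⟩ := (Ideal.subset_union_prime_finite (hfin.insert (maximalIdeal S ^ 2))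
        (f := id) (maximalIdeal S ^ 2) (maximalIdeal S ^ 2) (by
          intro i hi h1 _
          rcases hi with hi | hi
          · exact absurd hi h1
          · exact hi.1.1)).1 (fun x hx => by simpa using hcon x hx)
      rcases hp with rfl | hp
      · have : maximalIdeal S = ⊥ := by
          refine Submodule.eq_bot_of_le_smul_of_le_jacobson_bot (maximalIdeal S) _
            (IsNoetherian.noetherian _) ?_ (IsLocalRing.maximalIdeal_le_jacobson _)
          simpa [pow_two] using hle
        rw [this] at h
        simp at h
      · have hpm : p = maximalIdeal S :=
          le_antisymm (IsLocalRing.le_maximalIdeal hp.1.1.ne_top) hle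
        have h0 : (maximalIdeal S).height = 0 := by
          rw [← hpm]
          have := hp.1.1
          exact Ideal.height_eq_zero_iff.2 hp
        have h5 := IsRegularLocalRing.spanFinrank_maximalIdeal (R := S)
        rw [← IsLocalRing.maximalIdeal_height_eq_ringKrullDim, h0, h] at h5
        norm_cast at h5
    have hz2' : z ∉ maximalIdeal S ^ 2 := fun hh => hz2 (by simpa using Or.inl hh)
    obtain ⟨hreg, h1⟩ := isRegularLocalRing_quotient_span_singleton hz hz2'
    have hn : (maximalIdeal (S ⧸ Ideal.span {z})).spanFinrank = n := by omega
    have hdom := ih _ hn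
    have hprime : (Ideal.span {z}).IsPrime := (Ideal.Quotient.isDomain_iff_prime _).1 hdom
    obtain ⟨Q, hQ, hQz⟩ := Ideal.exists_minimalPrimes_le (I := ⊥) (J := Ideal.span {z}) bot_le
    have hzQ : z ∉ Q := fun hh => hz2 (by
      simp only [Set.mem_iUnion]
      exact ⟨Q, Or.inr hQ, hh⟩)
    have := hQ.1.1
    have hQ0 : Q = ⊥ := by
      refine Submodule.eq_bot_of_le_smul_of_le_jacobson_bot (maximalIdeal S) _
        (IsNoetherian.noetherian _) ?_ (IsLocalRing.maximalIdeal_le_jacobson _)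
      intro y hy
      obtain ⟨a, rfl⟩ := Ideal.mem_span_singleton'.1 (hQz hy)
      have ha : a ∈ Q := (hQ.1.1.mem_or_mem hy).resolve_right hzQ
      rw [mul_comm]
      exact Ideal.mul_mem_mul hz ha
    rw [hQ0] at this
    exact IsDomain.of_bot_isPrime S

theorem IsRegularLocalRing.isDomain (S : Type*) [CommRing S] [IsRegularLocalRing S] :
    IsDomain S :=
  IsRegularLocalRing.isDomain_aux _ S rfl

open RingTheory.Sequence Pointwise in
theorem IsRegularLocalRing.exists_isRegular (n : ℕ) : ∀ (S : Type*) [CommRing S]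
    [IsRegularLocalRing S], (maximalIdeal S).spanFinrank = n →
    ∃ rs : List S, rs.length = n ∧ (∀ r ∈ rs, r ∈ maximalIdeal S) ∧ IsRegular S rs := by
  induction n with
  | zero =>
    intro S _ _ h
    exact ⟨[], rfl, by simp, IsRegular.nil _ _⟩
  | succ n ih =>
    intro S _ _ h
    have := IsRegularLocalRing.isDomain S
    obtain ⟨z, hz, hz2⟩ : ∃ z ∈ maximalIdeal S, z ∉ maximalIdeal S ^ 2 := by
      by_contra! hcon
      have : maximalIdeal S = ⊥ := by
        refine Submodule.eq_bot_of_le_smul_of_le_jacobson_bot (maximalIdeal S) _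
          (IsNoetherian.noetherian _) ?_ (IsLocalRing.maximalIdeal_le_jacobson _)
        intro x hx
        simpa [pow_two] using hcon x hx
      rw [this] at h
      simp at h
    have hz0 : z ≠ 0 := fun h0 => hz2 (h0 ▸ zero_mem _)
    obtain ⟨hreg, h1⟩ := isRegularLocalRing_quotient_span_singleton hz hz2
    have hn : (maximalIdeal (S ⧸ Ideal.span {z})).spanFinrank = n := by omega
    obtain ⟨rs, hlen, hmem, hrs⟩ := ih _ hn
    obtain ⟨rs', rfl⟩ : ∃ rs' : List S, rs'.map (Ideal.Quotient.mk (Ideal.span {z})) = rs :=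
      List.map_surjective_iff.2 Ideal.Quotient.mk_surjective rs
    have hmem' : ∀ r ∈ z :: rs', r ∈ maximalIdeal S := by
      intro r hr
      rcases List.mem_cons.1 hr with rfl | hr
      · exact hz
      · have := hmem _ (List.mem_map_of_mem hr)
        have hc : (maximalIdeal (S ⧸ Ideal.span {z})).comap (Ideal.Quotient.mk _) =
            maximalIdeal S :=
          eq_maximalIdeal (Ideal.comap_isMaximal_of_surjective _ Ideal.Quotient.mk_surjective)
        rw [← hc]; exact this
    refine ⟨z :: rs', by simpa using hlen, hmem', ?_⟩
    rw [IsLocalRing.isRegular_iff_isWeaklyRegular_of_subset_maximalIdeal hmem']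
    refine (isWeaklyRegular_cons_iff S z rs').2 ⟨?_, ?_⟩
    · exact fun a b h => mul_left_cancel₀ hz0 (by simpa using h)
    · have h2 := (isWeaklyRegular_map_algebraMap_iff (S := S ⧸ Ideal.span {z})
        (M := S ⧸ Ideal.span {z}) rs').1 hrs.toIsWeaklyRegular
      have he : Ideal.span {z} = z • (⊤ : Submodule S S) := by
        rw [← Submodule.ideal_span_singleton_smul]; simp
      exact (LinearEquiv.isWeaklyRegular_congr (Submodule.quotEquivOfEq _ _ he) rs').1 h2

open RingTheory.Sequence Pointwise CategoryTheory Abelian Limits IsSMulRegular ModuleCat in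
theorem subsingleton_linearMap_quotient_of_subsingleton_ext {R : Type*} [CommRing R]
    (N : ModuleCat R) (rs : List R) : ∀ M : ModuleCat R, IsWeaklyRegular M rs →
      (∀ i < rs.length + 1, Subsingleton (Ext N M i)) →
      Subsingleton (N →ₗ[R] M ⧸ (Ideal.ofList rs • ⊤ : Submodule R M)) := by
  induction rs with
  | nil =>
    intro M _ hM
    have hE := hM 0 (by simp)
    have h0 : Subsingleton (N →ₗ[R] M) :=
      (Ext.addEquiv₀.trans ModuleCat.homAddEquiv).symm.subsingleton
    have e : (M ⧸ (Ideal.ofList ([] : List R) • ⊤ : Submodule R M)) ≃ₗ[R] M :=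
      Submodule.quotEquivOfEqBot _ (by rw [Ideal.ofList_nil, Submodule.bot_smul])
    exact (e.congrRight (M := N)).toEquiv.subsingleton
  | cons r rs ih =>
    intro M hM hext
    obtain ⟨hr, hrs⟩ := (isWeaklyRegular_cons_iff M r rs).1 hM
    have := ih (ModuleCat.of R (QuotSMulTop r M)) hrs fun i hi => by
      have zero1 := AddCommGrpCat.isZero_of_iff_subsingleton.mpr (hext i (by simp at hi ⊢; omega))
      have zero2 := AddCommGrpCat.isZero_of_iff_subsingleton.mpr
        (hext (i + 1) (by simp at hi ⊢; omega))
      exact AddCommGrpCat.subsingleton_of_isZero <| ShortComplex.Exact.isZero_of_both_zeros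
        ((Ext.covariant_sequence_exact₃' N hr.smulShortComplex_shortExact) i (i + 1) rfl)
        (zero1.eq_zero_of_src _) (zero2.eq_zero_of_tgt _)
    exact ((Submodule.quotOfListConsSMulTopEquivQuotSMulTopInner M r rs).congrRight
      (M := N)).toEquiv.subsingleton

open RingTheory.Sequence CategoryTheory in
theorem IsRegularLocalRing.spanFinrank_maximalIdeal_le_length {S : Type*} [CommRing S]
    [IsRegularLocalRing S] (rs : List S) (hrs : IsWeaklyRegular S rs) {u : S}
    (hu : u ∉ Ideal.ofList rs) (h : ∀ x ∈ maximalIdeal S, x * u ∈ Ideal.ofList rs) :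
    (maximalIdeal S).spanFinrank ≤ rs.length := by
  by_contra! hlt
  obtain ⟨xs, hlen, hmem, hxs⟩ := IsRegularLocalRing.exists_isRegular _ S rfl
  have hsub := subsingleton_linearMap_quotient_of_subsingleton_ext
    (ModuleCat.of S (S ⧸ maximalIdeal S)) rs (ModuleCat.of S S) hrs fun i hi =>
      ModuleCat.subsingleton_ext_of_exists_isRegular (maximalIdeal S) _
        (by rw [Module.support_eq_zeroLocus, Ideal.annihilator_quotient]) _
        (by
          have : (maximalIdeal S) ≠ ⊤ := (maximalIdeal.isMaximal S).ne_top
          simpa [lt_top_iff_ne_top] using this) xs hmem hxs i (by omega)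
  let J : Submodule S S := Ideal.ofList rs • ⊤
  have hJ : J = Ideal.ofList rs := by simp [J]
  let φ : (S ⧸ maximalIdeal S) →ₗ[S] S ⧸ J :=
    Submodule.liftQ _ (LinearMap.toSpanSingleton S _ (J.mkQ u)) (by
      intro x hx
      rw [LinearMap.mem_ker, LinearMap.toSpanSingleton_apply, ← map_smul, Submodule.mkQ_apply,
        Submodule.Quotient.mk_eq_zero, hJ]
      exact h x hx)
  have hφ : φ = 0 := hsub.elim _ _
  have h1 : φ (Submodule.Quotient.mk 1) = 0 := by rw [hφ]; rfl
  apply hu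
  rw [← hJ, ← Submodule.Quotient.mk_eq_zero]
  have h2 : φ (Submodule.Quotient.mk 1) = (1 : S) • J.mkQ u := rfl
  rw [h2, one_smul] at h1
  exact h1

end RegularLocal

section FormallySmooth
open KaehlerDifferential TensorProduct

theorem Algebra.FormallySmooth.of_linearIndependent_D {K L τ : Type*} [Field K] [Field L]
    [Algebra K L] [Algebra.FormallySmooth K L] [Algebra (MvPolynomial τ K) L]
    [IsScalarTower K (MvPolynomial τ K) L]
    (h : LinearIndependent L fun i => D K L (algebraMap (MvPolynomial τ K) L (X i))) :
    Algebra.FormallySmooth (MvPolynomial τ K) L := by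
  refine ⟨inferInstance, ?_⟩
  have hinj : Function.Injective (mapBaseChange K (MvPolynomial τ K) L) := by
    let b := (mvPolynomialBasis K τ).baseChange L
    have hb : ∀ i, mapBaseChange K (MvPolynomial τ K) L (b i) =
        D K L (algebraMap (MvPolynomial τ K) L (X i)) := by
      intro i
      simp [b, mvPolynomialBasis_apply]
    rw [injective_iff_map_eq_zero]
    intro x hx
    rw [← b.linearCombination_repr x, Finsupp.apply_linearCombination] at hx
    have : (mapBaseChange K (MvPolynomial τ K) L) ∘ b =
        fun i => D K L (algebraMap (MvPolynomial τ K) L (X i)) := funext hb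
    rw [this] at hx
    have h2 := (linearIndependent_iff.1 h) _ hx
    rwa [map_eq_zero_iff _ b.repr.injective] at h2
  refine ⟨fun a b => ?_⟩
  have hz : ∀ x : Algebra.H1Cotangent (MvPolynomial τ K) L, x = 0 := by
    intro x
    have h1 : Algebra.H1Cotangent.δ K (MvPolynomial τ K) L x = 0 := by
      apply hinj
      rw [map_zero]
      exact (Algebra.H1Cotangent.exact_δ_mapBaseChange K (MvPolynomial τ K) L _).2 ⟨x, rfl⟩
    obtain ⟨y, rfl⟩ := (Algebra.H1Cotangent.exact_map_δ K (MvPolynomial τ K) L x).1 h1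
    rw [Subsingleton.elim y 0, map_zero]
  rw [hz a, hz b]

theorem exists_algHom_lift_of_linearIndependent_D {K L τ B : Type*} [Field K] [Field L]
    [Algebra K L] [Algebra.FormallySmooth K L] (ξ : τ → L)
    (h : LinearIndependent L fun i => D K L (ξ i))
    [CommRing B] [Algebra K B] (g : B →ₐ[K] L) (hg : Function.Surjective g)
    (hn : IsNilpotent (RingHom.ker g)) (b : τ → B) (hb : ∀ i, g (b i) = ξ i) :
    ∃ ψ : L →ₐ[K] B, (∀ x, g (ψ x) = x) ∧ ∀ i, ψ (ξ i) = b i := by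
  let : Algebra (MvPolynomial τ K) L := (aeval ξ).toAlgebra
  let : Algebra (MvPolynomial τ K) B := (aeval b).toAlgebra
  have : IsScalarTower K (MvPolynomial τ K) L := .of_algHom (aeval ξ)
  have : IsScalarTower K (MvPolynomial τ K) B := .of_algHom (aeval b)
  have hL : ∀ i, algebraMap (MvPolynomial τ K) L (X i) = ξ i := fun i => aeval_X ξ i
  have hB : ∀ i, algebraMap (MvPolynomial τ K) B (X i) = b i := fun i => aeval_X b i
  have : Algebra.FormallySmooth (MvPolynomial τ K) L :=
    .of_linearIndependent_D (by simpa only [hL] using h)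
  have hcomm : g.comp (aeval b) = aeval ξ := by
    ext i; simp [hb]
  let g' : B →ₐ[MvPolynomial τ K] L :=
    { g.toRingHom with commutes' := fun p => congr($hcomm p) }
  let ψ := Algebra.FormallySmooth.liftOfSurjective (AlgHom.id (MvPolynomial τ K) L) g' hg hn
  refine ⟨ψ.restrictScalars K, fun x => ?_, fun i => ?_⟩
  · exact Algebra.FormallySmooth.liftOfSurjective_apply (AlgHom.id (MvPolynomial τ K) L) g' hg hn x
  · rw [← hL, ← hB]
    exact ψ.commutes _

open IsLocalRing in
theorem exists_finset_linearIndependent_D {K : Type*} [Field K] {N : ℕ}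
    (P : Ideal (MvPolynomial (Fin N) K)) [P.IsPrime] :
    ∃ T : Finset (Fin N), N ≤ T.card + (maximalIdeal (Localization.AtPrime P)).spanFinrank ∧
      LinearIndependent P.ResidueField fun i : T =>
        D K P.ResidueField (algebraMap (MvPolynomial (Fin N) K) P.ResidueField (X i)) := by
  let R := MvPolynomial (Fin N) K
  let S := Localization.AtPrime P
  let L := P.ResidueField
  have hsurj : Function.Surjective (algebraMap S L) := Ideal.Quotient.mk_surjective
  have : Algebra.FormallyEtale R S := Algebra.FormallyEtale.of_isLocalization P.primeCompl
  have hbc := isBaseChange_of_formallyEtale K R S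
  let b0 : Module.Basis (Fin N) S (Ω[S⁄K]) := hbc.basis (mvPolynomialBasis K (Fin N))
  let b : Module.Basis (Fin N) L (L ⊗[S] Ω[S⁄K]) := b0.baseChange L
  have hb : ∀ i, mapBaseChange K S L (b i) = D K L (algebraMap R L (X i)) := by
    intro i
    simp only [b, b0, Module.Basis.baseChange_apply, IsBaseChange.basis_apply,
      mvPolynomialBasis_apply, mapBaseChange_tmul, one_smul]
    rw [map_D]
    erw [map_D]
    rw [← IsScalarTower.algebraMap_apply R S L]
  obtain ⟨s, hs⟩ : ∃ s : Finset S, s.card = (maximalIdeal S).spanFinrank ∧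
      Ideal.span (s : Set S) = maximalIdeal S := by
    have hfg : (maximalIdeal S : Submodule S S).FG := IsNoetherian.noetherian _
    have hfin := Submodule.FG.finite_generators hfg
    refine ⟨hfin.toFinset, ?_, ?_⟩
    · rw [← Set.ncard_eq_toFinset_card _ hfin]; exact Submodule.FG.generators_ncard hfg
    · simpa using (maximalIdeal S).span_generators
  classical
  let W : Submodule L (L ⊗[S] Ω[S⁄K]) :=
    Submodule.span L (s.image fun x => (1 : L) ⊗ₜ[S] D K S x : Finset _)
  have hker : LinearMap.ker (mapBaseChange K S L) ≤ W := by
    intro y hy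
    have hy' : y ∈ LinearMap.range (kerCotangentToTensor K S L) := by
      rw [range_kerCotangentToTensor K S L hsurj]; exact hy
    obtain ⟨y, rfl⟩ := hy'
    obtain ⟨⟨x, hx⟩, rfl⟩ := Ideal.toCotangent_surjective _ y
    rw [kerCotangentToTensor_toCotangent]
    have hz : ∀ x ∈ maximalIdeal S, ∀ w : Ω[S⁄K], (1 : L) ⊗ₜ[S] (x • w) = 0 := by
      intro x hx w
      have : algebraMap S L x = 0 := Ideal.Quotient.eq_zero_iff_mem.2 hx
      have h2 : x • (1 : L) = 0 := by rw [Algebra.smul_def, this, zero_mul]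
      refine (TensorProduct.smul_tmul x (1 : L) w).symm.trans ?_
      rw [h2, TensorProduct.zero_tmul]
    have hx2 : x ∈ maximalIdeal S := by
      rw [RingHom.mem_ker] at hx
      exact Ideal.Quotient.eq_zero_iff_mem.1 hx
    have key : ∀ x ∈ Ideal.span (s : Set S), (1 : L) ⊗ₜ[S] D K S x ∈ W := by
      intro x hx
      induction hx using Submodule.span_induction with
      | mem x h =>
        exact Submodule.subset_span (Finset.mem_coe.2 (Finset.mem_image_of_mem _ h))
      | zero => simp
      | add x y _ _ hx hy =>
        rw [map_add, TensorProduct.tmul_add]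
        exact add_mem hx hy
      | smul a x hx' hx =>
        rw [smul_eq_mul, Derivation.leibniz, TensorProduct.tmul_add,
          hz x (by rw [← hs.2]; exact hx'), add_zero]
        have h3 := W.smul_of_tower_mem a hx
        convert h3 using 1
        exact TensorProduct.tmul_smul a (1 : L) (D K S x)
    exact key x (by rw [hs.2]; exact hx2)
  have : Module.Finite L (L ⊗[S] Ω[S⁄K]) := Module.Finite.of_basis b
  have hrn := LinearMap.finrank_range_add_finrank_ker (mapBaseChange K S L)
  rw [Module.finrank_eq_card_basis b, Fintype.card_fin,
    LinearMap.range_eq_top.2 (mapBaseChange_surjective K S L hsurj), finrank_top] at hrn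
  have hW : Module.finrank L W ≤ s.card :=
    (finrank_span_finset_le_card _).trans Finset.card_image_le
  have hkW := Submodule.finrank_mono hker
  obtain ⟨κ, a, ha, hspan, hli⟩ := exists_linearIndependent' L
    fun i : Fin N => D K L (algebraMap R L (X i))
  have htop : Submodule.span L (Set.range fun i : Fin N => D K L (algebraMap R L (X i))) = ⊤ := by
    have : (fun i : Fin N => D K L (algebraMap R L (X i))) = (mapBaseChange K S L) ∘ b :=
      funext fun i => (hb i).symm
    rw [this, Set.range_comp, ← Submodule.map_span, b.span_eq, Submodule.map_top]
    exact LinearMap.range_eq_top.2 (mapBaseChange_surjective K S L hsurj)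
  have : Finite κ := Finite.of_injective a ha
  have := Fintype.ofFinite κ
  refine ⟨Finset.univ.image a, ?_, ?_⟩
  · have hc : Module.finrank L (Ω[L⁄K]) ≤ Fintype.card κ := by
      rw [← finrank_top, ← htop, ← hspan]
      exact finrank_range_le_card _
    rw [Finset.card_image_of_injective _ ha, Finset.card_univ]
    rw [← hs.1]
    omega
  · let e : { i // i ∈ Finset.univ.image a } → κ := fun i =>
      (Finset.mem_image.1 i.2).choose
    have he : ∀ i, a (e i) = i := fun i => (Finset.mem_image.1 i.2).choose_spec.2
    have := hli.comp e (fun i j hij => Subtype.ext (by rw [← he i, ← he j, hij]))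
    convert this using 1
    funext i
    rw [Function.comp_apply, Function.comp_apply, he]
end FormallySmooth

section Taylor

attribute [local instance] MvPolynomial.gradedAlgebra in
theorem MvPolynomial.homogeneousComponent_mul_of_isHomogeneous {σ A : Type*} [CommSemiring A]
    (a : MvPolynomial σ A) {b : MvPolynomial σ A} {j n : ℕ} (hb : b.IsHomogeneous j) (hj : j ≤ n) :
    homogeneousComponent n (a * b) = homogeneousComponent (n - j) a * b := by
  have := DirectSum.coe_decompose_mul_of_right_mem_of_le (homogeneousSubmodule σ A) (a := a)
    (b := b) (i := j) (n := n) hb hj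
  have h2 (p : MvPolynomial σ A) (n : ℕ) :
      (DirectSum.decompose (homogeneousSubmodule σ A) p n : MvPolynomial σ A) =
        homogeneousComponent n p := decomposition.decompose'_apply p n
  rwa [h2, h2] at this

theorem MvPolynomial.homogeneousComponent_eq_zero_of_mem_pow_idealOfVars {σ A : Type*} [CommRing A]
    {p : MvPolynomial σ A} {m n : ℕ} (hp : p ∈ idealOfVars σ A ^ n) (h : m < n) :
    homogeneousComponent m p = 0 := by
  ext x
  rw [coeff_homogeneousComponent, coeff_zero]
  split_ifs with hx
  · exact (mem_pow_idealOfVars_iff' _ _).1 hp x (hx ▸ h)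
  · rfl

theorem MvPolynomial.aeval_sub_aeval_mem {σ A B : Type*} [CommRing A] [CommRing B] [Algebra A B]
    {J : Ideal B} {a b : σ → B} (h : ∀ j, a j - b j ∈ J) (G : MvPolynomial σ A) :
    aeval a G - aeval b G ∈ J := by
  rw [← Ideal.Quotient.eq, ← Ideal.Quotient.mkₐ_eq_mk A, ← AlgHom.comp_apply,
    ← AlgHom.comp_apply, comp_aeval,
    comp_aeval]
  congr 2
  funext j
  exact Ideal.Quotient.eq.2 (h j)

theorem MvPolynomial.aeval_add_sub_mem_sq {σ A B : Type*} [Fintype σ] [CommRing A] [CommRing B]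
    [Algebra A B] {J : Ideal B} (a : σ → B) {z : σ → B} (hz : ∀ j, z j ∈ J)
    (G : MvPolynomial σ A) :
    aeval (fun j => a j + z j) G - aeval a G - ∑ j, aeval a (pderiv j G) * z j ∈ J ^ 2 := by
  classical
  induction G using MvPolynomial.induction_on with
  | C r => simp
  | add p q hp hq =>
    have := add_mem hp hq
    convert this using 1
    simp only [map_add, add_mul, Finset.sum_add_distrib]
    ring
  | mul_X p i hp =>
    have h1 : aeval (fun j => a j + z j) p - aeval a p ∈ J := aeval_sub_aeval_mem (by simpa) p
    have h2 := add_mem (Ideal.mul_mem_right (a i) _ hp)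
      (by rw [pow_two]; exact Ideal.mul_mem_mul h1 (hz i) : _ ∈ J ^ 2)
    convert h2 using 1
    have : ∑ j, aeval a (pderiv j (p * X i)) * z j =
        (∑ j, aeval a (pderiv j p) * z j) * a i + aeval a p * z i := by
      simp only [Derivation.leibniz, pderiv_X, smul_eq_mul, map_add, map_mul, add_mul,
        Finset.sum_add_distrib, aeval_X]
      rw [add_comm, Finset.sum_mul]
      congr 1
      · exact Finset.sum_congr rfl fun j _ => by ring
      · rw [Finset.sum_eq_single i]
        · simp
        · intro j _ hj
          simp [hj.symm]
        · simp
    rw [this]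
    simp only [map_mul, aeval_X]
    ring

theorem MvPolynomial.homogeneousComponent_aeval_C_add_X {σ A : Type*} [CommRing A] (ξ : σ → A)
    {G : MvPolynomial σ A} {m n : ℕ} (hG : G.IsHomogeneous m) (h : m ≤ n) :
    homogeneousComponent n (aeval (fun j => C (ξ j) + X j) G) = homogeneousComponent n G := by
  classical
  have key : ∀ (m : ℕ) (s : σ →₀ ℕ) (r : A), s.degree = m → ∀ n, m ≤ n →
      homogeneousComponent n (aeval (fun j => C (ξ j) + X j) (monomial s r)) =
        homogeneousComponent n (monomial s r) := by
    intro m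
    induction m with
    | zero =>
      intro s r hs n _
      obtain rfl : s = 0 := (Finsupp.degree_eq_zero_iff s).1 hs
      rw [monomial_zero', aeval_C]; rfl
    | succ m ih =>
      intro s r hs n hn
      obtain ⟨i, hi⟩ : ∃ i, s i ≠ 0 := by
        by_contra! hc
        have : s = 0 := Finsupp.ext hc
        simp [this] at hs
      obtain ⟨t, rfl⟩ : ∃ t, s = t + Finsupp.single i 1 :=
        ⟨s - Finsupp.single i 1, (tsub_add_cancel_of_le (by
          simpa [Finsupp.single_le_iff] using Nat.one_le_iff_ne_zero.2 hi)).symm⟩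
      have ht : t.degree = m := by simpa [map_add] using hs
      have e1 : (monomial (t + Finsupp.single i 1) r : MvPolynomial σ A) = monomial t r * X i := by
        rw [X, monomial_mul, mul_one]
      have h0 : homogeneousComponent n (monomial t r : MvPolynomial σ A) = 0 := by
        refine homogeneousComponent_eq_zero _ _ (lt_of_le_of_lt (totalDegree_monomial_le _ _) ?_)
        change t.degree < n
        omega
      rw [e1, map_mul, aeval_X, mul_add, map_add, mul_comm _ (C (ξ i)), homogeneousComponent_C_mul,
        ih t r ht n (by omega), h0, mul_zero, zero_add,
        homogeneousComponent_mul_of_isHomogeneous _ (isHomogeneous_X _ i) (by omega),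
        homogeneousComponent_mul_of_isHomogeneous _ (isHomogeneous_X _ i) (by omega),
        ih t r ht (n - 1) (by omega)]
  conv_lhs => rw [G.as_sum]
  conv_rhs => rw [G.as_sum]
  simp only [map_sum]
  refine Finset.sum_congr rfl fun s hs => key m s _ ?_ n h
  by_contra hne
  exact (mem_support_iff.1 hs) (hG.coeff_eq_zero hne)

end Taylor

section LowStrength

/-- `F` is a sum of at most `s` products of two forms of positive degrees with degree sum `e`. -/
def MvPolynomial.HasLowStrength {σ A : Type*} [CommSemiring A] (e s : ℕ) (F : MvPolynomial σ A) :
    Prop :=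
  ∃ (r : ℕ) (p q : Fin r → ℕ) (a b : Fin r → MvPolynomial σ A), r ≤ s ∧
    (∀ t, 0 < p t ∧ 0 < q t ∧ p t + q t = e ∧ (a t).IsHomogeneous (p t) ∧
      (b t).IsHomogeneous (q t)) ∧ F = ∑ t, a t * b t

theorem MvPolynomial.HasLowStrength.of_mem_span {σ A ι : Type*} [CommRing A] [Fintype ι] {e s : ℕ}
    {F : MvPolynomial σ A} (hF : F.IsHomogeneous e) (h : ι → MvPolynomial σ A) (p : ι → ℕ)
    (hh : ∀ t, (h t).IsHomogeneous (p t)) (hp : ∀ t, 0 < p t ∧ p t < e)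
    (hs : Fintype.card ι ≤ s) (hmem : F ∈ Ideal.span (Set.range h)) : HasLowStrength e s F := by
  obtain ⟨c, hc⟩ := (Ideal.mem_span_range_iff_exists_fun).1 hmem
  let ε := (Fintype.equivFin ι).symm
  refine ⟨Fintype.card ι, fun t => p (ε t), fun t => e - p (ε t), fun t => h (ε t),
    fun t => homogeneousComponent (e - p (ε t)) (c (ε t)), hs, fun t => ?_, ?_⟩
  · have := hp (ε t)
    exact ⟨this.1, Nat.sub_pos_of_lt this.2, Nat.add_sub_cancel' this.2.le, hh _,
      homogeneousComponent_isHomogeneous _ _⟩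
  · rw [ε.sum_comp fun t => h t * homogeneousComponent (e - p t) (c t),
      ← homogeneousComponent_eq_self hF, ← hc, map_sum]
    refine Finset.sum_congr rfl fun t _ => ?_
    rw [homogeneousComponent_mul_of_isHomogeneous _ (hh t) (hp t).2.le, mul_comm]

open KaehlerDifferential in
theorem exists_mvPolynomial_lift_of_linearIndependent_D {K L : Type*} [Field K] [Field L]
    [Algebra K L] [Algebra.FormallySmooth K L] {N : ℕ} (ξ : Fin N → L) (T : Finset (Fin N))
    (h : LinearIndependent L fun i : T => D K L (ξ i)) (n : ℕ) :
    ∃ u : Fin N → MvPolynomial (Fin N) L, (∀ j, u j - C (ξ j) ∈ idealOfVars (Fin N) L) ∧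
      (∀ j ∈ T, u j = C (ξ j) + X j) ∧
      ∀ f : MvPolynomial (Fin N) K, aeval ξ f = 0 →
        aeval u f ∈ idealOfVars (Fin N) L ^ (n + 1) := by
  let J := idealOfVars (Fin N) L
  let π := Ideal.Quotient.mkₐ K (J ^ (n + 1))
  have hcc : ∀ p : MvPolynomial (Fin N) L, p ∈ J ↔ constantCoeff p = 0 := by
    intro p
    have := mem_pow_idealOfVars_iff' (σ := Fin N) 1 p
    rw [pow_one] at this
    rw [this, constantCoeff_eq]
    refine ⟨fun h => h 0 (by simp), fun h x hx => ?_⟩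
    have : x = 0 := (Finsupp.degree_eq_zero_iff x).1 (by omega)
    rwa [this]
  have hpow : ∀ p ∈ J ^ (n + 1), constantCoeff p = 0 := fun p hp =>
    (hcc p).1 (Ideal.pow_le_self (Nat.succ_ne_zero n) hp)
  let g0 : MvPolynomial (Fin N) L →ₐ[K] L :=
    (aeval (fun _ => (0 : L)) : MvPolynomial (Fin N) L →ₐ[L] L).restrictScalars K
  have hg0 : ∀ p, g0 p = constantCoeff p := fun p => by simp [g0]
  let g : (MvPolynomial (Fin N) L ⧸ J ^ (n + 1)) →ₐ[K] L :=
    Ideal.Quotient.liftₐ _ g0 fun p hp => by rw [hg0, hpow p hp]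
  have hgπ : ∀ p, g (π p) = constantCoeff p := fun p => hg0 p
  have hg : Function.Surjective g := fun x => ⟨π (C x), by rw [hgπ]; simp⟩
  have hn : IsNilpotent (RingHom.ker g) := by
    refine ⟨n + 1, ?_⟩
    have : RingHom.ker g ≤ J.map (Ideal.Quotient.mk (J ^ (n + 1))) := by
      intro x hx
      obtain ⟨p, rfl⟩ := Ideal.Quotient.mk_surjective x
      exact Ideal.mem_map_of_mem _ ((hcc p).2 ((hgπ p).symm.trans hx))
    rw [Ideal.zero_eq_bot, eq_bot_iff]
    refine (Ideal.pow_right_mono this _).trans ?_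
    rw [← Ideal.map_pow, Ideal.map_quotient_self]
  obtain ⟨ψ, hψ, hψT⟩ := exists_algHom_lift_of_linearIndependent_D (fun i : T => ξ i) h g hg hn
    (fun i => π (C (ξ i) + X i.1)) (fun i => by rw [hgπ]; simp)
  classical
  choose w hw using fun j => Ideal.Quotient.mk_surjective (ψ (ξ j))
  let u : Fin N → MvPolynomial (Fin N) L := fun j => if j ∈ T then C (ξ j) + X j else w j
  have hu : ∀ j, π (u j) = ψ (ξ j) := by
    intro j
    by_cases hj : j ∈ T
    · simp only [u, if_pos hj]
      exact (hψT ⟨j, hj⟩).symm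
    · simp only [u, if_neg hj]
      exact hw j
  refine ⟨u, fun j => ?_, fun j hj => if_pos hj, fun f hf => ?_⟩
  · rw [hcc, map_sub, ← hgπ, hu, hψ]; simp
  · have h1 : π.comp (aeval u) = ψ.comp (aeval ξ) := by
      ext i; simp [hu]
    have h2 : π (aeval u f) = ψ (aeval ξ f) := congr($h1 f)
    rw [hf, map_zero] at h2
    exact Ideal.Quotient.eq_zero_iff_mem.1 h2

attribute [local instance] MvPolynomial.gradedAlgebra in
theorem exists_hasLowStrength_of_aeval_mem {L : Type*} [Field L] {N k : ℕ}
    (f : Fin k → MvPolynomial (Fin N) L) (e : Fin k → ℕ) (hf : ∀ i, (f i).IsHomogeneous (e i))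
    (he : ∀ i, 0 < e i) {n : ℕ} (hen : ∀ i, e i ≤ n) (T : Finset (Fin N)) (hT : N < T.card + k)
    (ξ : Fin N → L) (u : Fin N → MvPolynomial (Fin N) L)
    (hu : ∀ j, u j - C (ξ j) ∈ idealOfVars (Fin N) L) (huT : ∀ j ∈ T, u j = C (ξ j) + X j)
    (hfu : ∀ i, aeval u (f i) ∈ idealOfVars (Fin N) L ^ (n + 1)) :
    ∃ (lam : Fin k → L) (e₀ : ℕ), (∃ i, lam i ≠ 0) ∧ (∀ i, lam i ≠ 0 → e i = e₀) ∧
      HasLowStrength e₀ (k * (e₀ - 1)) (∑ i, lam i • f i) := by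
  classical
  let J := idealOfVars (Fin N) L
  obtain ⟨lam, hlam, i₁, hi₁⟩ : ∃ lam : Fin k → L,
      (∑ i, lam i • (fun j : (Tᶜ : Finset (Fin N)) => eval ξ (pderiv j.1 (f i)))) = 0 ∧
        ∃ i, lam i ≠ 0 := by
    have : ¬ LinearIndependent L
        fun i : Fin k => (fun j : (Tᶜ : Finset (Fin N)) => eval ξ (pderiv j.1 (f i))) := by
      intro hli
      have := hli.fintype_card_le_finrank
      have hle := T.card_le_univ
      simp at this hle
      omega
    simpa using Fintype.not_linearIndependent_iff.1 this
  obtain ⟨i₀, hi₀, hmax⟩ := Finset.exists_max_image (Finset.univ.filter fun i => lam i ≠ 0) e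
    ⟨i₁, by simpa using hi₁⟩
  simp only [Finset.mem_filter, Finset.mem_univ, true_and] at hi₀ hmax
  set e₀ := e i₀ with he₀
  have he₀pos : 0 < e₀ := he _
  let G := ∑ i, lam i • f i
  let F := ∑ i, (if e i = e₀ then lam i else 0) • f i
  have hFhom : F.IsHomogeneous e₀ := by
    refine IsHomogeneous.sum _ _ _ fun i _ => ?_
    split_ifs with h
    · rw [smul_eq_C_mul]; exact (h ▸ hf i).C_mul _
    · rw [zero_smul]; exact isHomogeneous_zero _ _ _
  have hcompG : homogeneousComponent e₀ G = F := by
    simp only [G, F, map_sum, map_smul]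
    refine Finset.sum_congr rfl fun i _ => ?_
    split_ifs with h
    · rw [homogeneousComponent_eq_self (h ▸ hf i)]
    · rw [homogeneousComponent_of_mem (hf i), if_neg (Ne.symm h), smul_zero, zero_smul]
  refine ⟨fun i => if e i = e₀ then lam i else 0, e₀, ⟨i₀, by simpa [he₀] using hi₀⟩,
    fun i hi => ?_, ?_⟩
  · by_contra h; simp [h] at hi
  let Δ : Fin N → MvPolynomial (Fin N) L := fun j => u j - C (ξ j) - X j
  let h : (Tᶜ : Finset (Fin N)) × Fin (e₀ - 1) → MvPolynomial (Fin N) L := fun t =>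
    homogeneousComponent (t.2 + 1) (Δ t.1)
  have hh : ∀ t, (h t).IsHomogeneous (t.2 + 1) := fun t => homogeneousComponent_isHomogeneous _ _
  refine HasLowStrength.of_mem_span hFhom h (fun t => t.2 + 1) hh (fun t => by omega) ?_ ?_
  · simp only [Fintype.card_prod, Fintype.card_coe, Finset.card_compl, Fintype.card_fin]
    exact Nat.mul_le_mul_right _ (by omega)
  let H := Ideal.span (Set.range h)
  change F ∈ H
  let w : Fin N → MvPolynomial (Fin N) L := fun j =>
    ∑ m : Fin (e₀ - 1), homogeneousComponent (m + 1) (Δ j)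
  let z : Fin N → MvPolynomial (Fin N) L := fun j => Δ j - w j
  have hΔT : ∀ j ∈ T, Δ j = 0 := fun j hj => by simp [Δ, huT j hj]
  have hzT : ∀ j ∈ T, z j = 0 := fun j hj => by simp [z, w, hΔT j hj]
  have hwH : ∀ j, w j ∈ H := by
    intro j
    by_cases hj : j ∈ T
    · simp [w, hΔT j hj]
    · exact sum_mem fun m _ => Ideal.subset_span ⟨(⟨j, by simpa using hj⟩, m), rfl⟩
  have hXJ : ∀ j, (X j : MvPolynomial (Fin N) L) ∈ J := fun j => Ideal.subset_span ⟨j, rfl⟩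
  have hΔJ : ∀ j, Δ j ∈ J := fun j => sub_mem (hu j) (hXJ j)
  have hwJ : ∀ j, w j ∈ J := by
    intro j
    refine sum_mem fun m _ => ?_
    rw [← pow_one J]
    refine (mem_pow_idealOfVars_iff' _ _).2 fun x hx => ?_
    rw [coeff_homogeneousComponent, if_neg (by omega)]
  have hzJ : ∀ j, z j ∈ J ^ e₀ := by
    intro j
    refine (mem_pow_idealOfVars_iff' _ _).2 fun x hx => ?_
    simp only [z, w, coeff_sub, coeff_sum, coeff_homogeneousComponent]
    by_cases hx0 : x.degree = 0
    · have h1 := hΔJ j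
      rw [← pow_one J] at h1
      rw [(mem_pow_idealOfVars_iff' _ _).1 h1 x (by omega)]
      simp
    · rw [Finset.sum_eq_single (⟨x.degree - 1, by omega⟩ : Fin (e₀ - 1))]
      · rw [if_pos (by simp; omega), sub_self]
      · intro m _ hm
        rw [if_neg]
        intro h3
        exact hm (Fin.ext (by simp; omega))
      · simp
  let a : Fin N → MvPolynomial (Fin N) L := fun j => (C (ξ j) + X j) + w j
  have hua : u = fun j => a j + z j := by
    funext j; simp only [a, z, Δ]; ring
  have hsq : (J ^ e₀) ^ 2 ≤ J ^ (e₀ + 1) := by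
    rw [← pow_mul]; exact Ideal.pow_le_pow_right (by omega)
  have h1 : aeval u G - aeval a G - ∑ j, aeval a (pderiv j G) * z j ∈ J ^ (e₀ + 1) := by
    rw [hua]; exact hsq (aeval_add_sub_mem_sq a hzJ G)
  have h2 : ∑ j, aeval a (pderiv j G) * z j ∈ J ^ (e₀ + 1) := by
    refine sum_mem fun j _ => ?_
    by_cases hj : j ∈ T
    · rw [hzT j hj, mul_zero]; exact zero_mem _
    · have h3 : aeval a (pderiv j G) - aeval (fun j => C (ξ j)) (pderiv j G) ∈ J :=
        aeval_sub_aeval_mem (fun j => by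
          have : a j - C (ξ j) = X j + w j := by simp only [a]; ring
          rw [this]; exact add_mem (hXJ j) (hwJ j)) _
      have h4 : aeval (fun j => C (ξ j)) (pderiv j G) =
          (C (eval ξ (pderiv j G)) : MvPolynomial (Fin N) L) := by
        have : (aeval (fun j => (C (ξ j) : MvPolynomial (Fin N) L)) :
            MvPolynomial (Fin N) L →ₐ[L] MvPolynomial (Fin N) L) =
            (Algebra.ofId L _).comp (aeval ξ) := by
          ext i; simp [Algebra.ofId_apply, algebraMap_eq]
        rw [this]; rfl
      have h5 : eval ξ (pderiv j G) = 0 := by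
        have := congr_fun hlam ⟨j, by simpa using hj⟩
        simpa [G, Finset.sum_apply] using this
      rw [h4, h5, map_zero, sub_zero] at h3
      rw [pow_succ']
      exact Ideal.mul_mem_mul h3 (hzJ j)
  have h3 : aeval u G ∈ J ^ (e₀ + 1) := by
    simp only [G, map_sum, map_smul]
    refine sum_mem fun i _ => ?_
    rw [smul_eq_C_mul]
    exact Ideal.mul_mem_left _ _ (Ideal.pow_le_pow_right (by have := hen i₀; omega) (hfu i))
  have h4 : homogeneousComponent e₀ (aeval a G) = 0 := by
    refine homogeneousComponent_eq_zero_of_mem_pow_idealOfVars (n := e₀ + 1) ?_ (by omega)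
    have := sub_mem (sub_mem h3 h1) h2
    convert this using 1
    ring
  have h5 : aeval a G - aeval (fun j => C (ξ j) + X j) G ∈ H :=
    aeval_sub_aeval_mem (fun j => by simpa [a] using hwH j) G
  have hHhom : H.IsHomogeneous (homogeneousSubmodule (Fin N) L) :=
    Ideal.homogeneous_span _ _ (by rintro _ ⟨t, rfl⟩; exact ⟨_, hh t⟩)
  have h6 := homogeneousComponent_mem_of_mem hHhom h5 e₀
  have h7 : homogeneousComponent e₀ (aeval (fun j => C (ξ j) + X j) G) = F := by
    rw [← hcompG]
    simp only [G, map_sum, map_smul]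
    refine Finset.sum_congr rfl fun i _ => ?_
    by_cases hi : lam i = 0
    · simp [hi]
    · rw [homogeneousComponent_aeval_C_add_X ξ (hf i) (hmax i hi)]
  rw [map_sub, h4, h7, zero_sub] at h6
  simpa using h6

theorem exists_algHom_of_finiteType (K B : Type*) [Field K] [IsAlgClosed K] [CommRing B]
    [Nontrivial B] [Algebra K B] [Algebra.FiniteType K B] : Nonempty (B →ₐ[K] K) := by
  obtain ⟨M, hM⟩ := Ideal.exists_maximal B
  let := Ideal.Quotient.field M
  have : Module.Finite K (B ⧸ M) := finite_of_finite_type_of_isJacobsonRing K (B ⧸ M)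
  exact ⟨(IsAlgClosed.lift : (B ⧸ M) →ₐ[K] K).comp (Ideal.Quotient.mkₐ K M)⟩

theorem MvPolynomial.HasLowStrength.exists_of_map {K L σ : Type*} [Field K] [IsAlgClosed K]
    [Field L] [Algebra K L] {k e s : ℕ} (f : Fin k → MvPolynomial σ K) (lam : Fin k → L)
    {i₀ : Fin k} (hi₀ : lam i₀ ≠ 0)
    (h : HasLowStrength e s (∑ i, lam i • map (algebraMap K L) (f i))) :
    ∃ μ : Fin k → K, μ i₀ ≠ 0 ∧ (∀ i, lam i = 0 → μ i = 0) ∧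
      HasLowStrength e s (∑ i, μ i • f i) := by
  classical
  obtain ⟨r, p, q, a, b, hr, hab, hsum⟩ := h
  let S : Finset L := (Finset.univ.biUnion fun t => (a t).coeffs ∪ (b t).coeffs) ∪
    insert (lam i₀)⁻¹ (Finset.univ.image lam)
  let B := Algebra.adjoin K (S : Set L)
  have : Algebra.FiniteType K B := (Subalgebra.fg_iff_finiteType _).1 ⟨S, rfl⟩
  obtain ⟨φ⟩ := exists_algHom_of_finiteType K B
  have hSB : ∀ x ∈ S, x ∈ B := fun x hx => Algebra.subset_adjoin hx
  have hrange : Set.range (algebraMap B L) = B := by ext; simp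
  have ha : ∀ t, ∃ a' : MvPolynomial σ B, map (algebraMap B L) a' = a t := fun t =>
    mem_range_map_iff_coeffs_subset.2 fun x hx => hrange ▸ hSB x (by
      simp only [S, Finset.mem_union, Finset.mem_biUnion]
      exact Or.inl ⟨t, Finset.mem_univ _, Or.inl hx⟩)
  have hb : ∀ t, ∃ b' : MvPolynomial σ B, map (algebraMap B L) b' = b t := fun t =>
    mem_range_map_iff_coeffs_subset.2 fun x hx => hrange ▸ hSB x (by
      simp only [S, Finset.mem_union, Finset.mem_biUnion]
      exact Or.inl ⟨t, Finset.mem_univ _, Or.inr hx⟩)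
  choose a' ha' using ha
  choose b' hb' using hb
  have hl : ∀ i, lam i ∈ B := fun i => hSB _ (by simp [S])
  let lam' : Fin k → B := fun i => ⟨lam i, hl i⟩
  have hinj : Function.Injective (algebraMap B L) := Subtype.val_injective
  have hinjm := map_injective (σ := σ) _ hinj
  have hsum' : ∑ i, lam' i • map (algebraMap K B) (f i) = ∑ t, a' t * b' t := by
    apply hinjm
    simp only [map_sum, map_mul, ha', hb', smul_eq_C_mul, map_C, map_map]
    rw [← hsum]
    refine Finset.sum_congr rfl fun i _ => ?_
    rw [smul_eq_C_mul]; rfl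
  refine ⟨fun i => φ (lam' i), ?_, fun i hi => ?_, r, p, q, fun t => map φ.toRingHom (a' t),
    fun t => map φ.toRingHom (b' t), hr, fun t => ?_, ?_⟩
  · have hinv : (lam i₀)⁻¹ ∈ B := hSB _ (by simp [S])
    have : lam' i₀ * ⟨_, hinv⟩ = 1 := Subtype.ext (mul_inv_cancel₀ hi₀)
    intro h0
    change φ (lam' i₀) = 0 at h0
    have h1 := congr(φ $this)
    rw [map_mul, h0, zero_mul, map_one] at h1
    exact zero_ne_one h1
  · have : lam' i = 0 := Subtype.ext hi
    change φ (lam' i) = 0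
    rw [this, map_zero]
  · obtain ⟨h1, h2, h3, h4, h5⟩ := hab t
    refine ⟨h1, h2, h3, ?_, ?_⟩
    · exact (IsHomogeneous.of_map hinj (by rw [ha']; exact h4)).map _
    · exact (IsHomogeneous.of_map hinj (by rw [hb']; exact h5)).map _
  · have := congr(map φ.toRingHom $hsum')
    simp only [map_sum, map_mul, smul_eq_C_mul, map_C, map_map] at this
    rw [← this]
    refine Finset.sum_congr rfl fun i _ => ?_
    have hid : φ.toRingHom.comp (algebraMap K B) = RingHom.id K := by
      ext x; exact φ.commutes x
    rw [hid, map_id, smul_eq_C_mul]; rfl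

end LowStrength

section StrongFamily
open RingTheory.Sequence

theorem MvPolynomial.HasLowStrength.mono {σ A : Type*} [CommRing A] {e s t : ℕ}
    {F : MvPolynomial σ A} (h : HasLowStrength e s F) (hst : s ≤ t) : HasLowStrength e t F := by
  obtain ⟨r, p, q, a, b, hr, h⟩ := h
  exact ⟨r, p, q, a, b, hr.trans hst, h⟩

/-- A family of forms `g i` of degrees `e i` is `s`-strong if no nontrivial homogeneous linear
combination, of degree `e₀` say, is a sum of at most `s * (e₀ - 1)` products of forms of smaller
positive degree. -/
def MvPolynomial.IsStrongFamily {σ A ι : Type*} [CommRing A] [Fintype ι] (s : ℕ)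
    (g : ι → MvPolynomial σ A) (e : ι → ℕ) : Prop :=
  ∀ (e₀ : ℕ) (μ : ι → A), (∃ i, μ i ≠ 0) → (∀ i, μ i ≠ 0 → e i = e₀) →
    ¬ HasLowStrength e₀ (s * (e₀ - 1)) (∑ i, μ i • g i)

theorem formallySmooth_residueField {K : Type*} [Field K] [PerfectField K] {N : ℕ}
    (P : Ideal (MvPolynomial (Fin N) K)) [P.IsPrime] :
    Algebra.FormallySmooth K P.ResidueField := by
  have : Algebra.EssFiniteType (MvPolynomial (Fin N) K) (Localization.AtPrime P) :=
    Algebra.EssFiniteType.of_isLocalization _ P.primeCompl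
  have : Algebra.EssFiniteType K P.ResidueField :=
    Algebra.EssFiniteType.comp K (MvPolynomial (Fin N) K) P.ResidueField
  exact Algebra.FormallySmooth.of_perfectField

theorem MvPolynomial.not_isStrongFamily_of_associatedPrime {K : Type*} [Field K] [IsAlgClosed K]
    {N n s : ℕ} (hn : n + 1 ≤ s) (g : Fin (n + 1) → MvPolynomial (Fin N) K)
    (e : Fin (n + 1) → ℕ) (hg : ∀ i, (g i).IsHomogeneous (e i)) (he : ∀ i, 0 < e i)
    (P : Ideal (MvPolynomial (Fin N) K)) [P.IsPrime] (hP : ∀ i, g i ∈ P)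
    (rs : List (MvPolynomial (Fin N) K)) (hlen : rs.length = n)
    (hrs : IsWeaklyRegular (MvPolynomial (Fin N) K) rs)
    {u : MvPolynomial (Fin N) K} (hu : ∀ x, x * u ∈ Ideal.ofList rs ↔ x ∈ P) :
    ¬ IsStrongFamily s g e := by
  intro hst
  let S := Localization.AtPrime P
  have hmapJ : Ideal.ofList (rs.map (algebraMap _ S)) = (Ideal.ofList rs).map (algebraMap _ S) :=
    (Ideal.map_ofList _ _).symm
  have hlt := IsRegularLocalRing.spanFinrank_maximalIdeal_le_length (S := S) _
    (IsWeaklyRegular.of_isLocalization S P.primeCompl hrs) (u := algebraMap _ S u) (by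
      rw [hmapJ, IsLocalization.algebraMap_mem_map_algebraMap_iff P.primeCompl]
      rintro ⟨m, hm, h⟩
      exact hm ((hu m).1 h)) (by
      intro x hx
      rw [hmapJ]
      obtain ⟨a, m, rfl⟩ := IsLocalization.exists_mk'_eq P.primeCompl x
      have ha : a ∈ P := (IsLocalization.AtPrime.mk'_mem_maximal_iff S P a m).1 hx
      have := Ideal.mem_map_of_mem (algebraMap _ S) ((hu a).2 ha)
      rw [map_mul] at this
      rw [IsLocalization.mk'_eq_mul_mk'_one, mul_right_comm]
      exact Ideal.mul_mem_right _ _ this)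
  rw [List.length_map, hlen] at hlt
  change (IsLocalRing.maximalIdeal (Localization.AtPrime P)).spanFinrank ≤ n at hlt
  obtain ⟨T, hT, hli⟩ := exists_finset_linearIndependent_D P
  have := formallySmooth_residueField P
  let L := P.ResidueField
  obtain ⟨v, hv1, hv2, hv3⟩ := exists_mvPolynomial_lift_of_linearIndependent_D
    (fun j => algebraMap (MvPolynomial (Fin N) K) L (X j)) T hli (Finset.univ.sup e)
  have hξ : ∀ i, aeval (fun j => algebraMap (MvPolynomial (Fin N) K) L (X j)) (g i) = 0 := by
    intro i
    have : aeval (fun j => algebraMap (MvPolynomial (Fin N) K) L (X j)) =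
        IsScalarTower.toAlgHom K (MvPolynomial (Fin N) K) L := by
      ext j; simp
    rw [this]
    exact Ideal.algebraMap_residueField_eq_zero.2 (hP i)
  obtain ⟨lam, e₀, ⟨i₀, hi₀⟩, hdeg, hlow⟩ := exists_hasLowStrength_of_aeval_mem
    (fun i => map (algebraMap K L) (g i)) e (fun i => (hg i).map _) he
    (fun i => Finset.le_sup (Finset.mem_univ i)) T (by omega) _ v hv1 hv2 (fun i => by
      have := hv3 _ (hξ i)
      rwa [← aeval_map_algebraMap L] at this)
  obtain ⟨μ, h1, h2, h3⟩ := HasLowStrength.exists_of_map g lam hi₀ hlow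
  exact hst e₀ μ ⟨i₀, h1⟩ (fun i hi => hdeg i fun h => hi (h2 i h))
    (h3.mono (Nat.mul_le_mul_right _ hn))

theorem MvPolynomial.IsStrongFamily.isWeaklyRegular {K : Type*} [Field K] [IsAlgClosed K]
    {N s : ℕ} (n : ℕ) : n ≤ s → ∀ (g : Fin n → MvPolynomial (Fin N) K)
    (e : Fin n → ℕ), (∀ i, (g i).IsHomogeneous (e i)) → (∀ i, 0 < e i) →
    IsStrongFamily s g e → IsWeaklyRegular (MvPolynomial (Fin N) K) (List.ofFn g) := by
  induction n with
  | zero => intro _ g e _ _ _; rw [List.ofFn_zero]; exact .nil _ _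
  | succ n ih =>
    intro hn g e hg he hst
    let R := MvPolynomial (Fin N) K
    have h1 := ih (by omega) (fun i => g i.castSucc) (fun i => e i.castSucc) (fun i => hg _)
      (fun i => he _) (by
        intro e₀ μ ⟨i, hi⟩ hμ
        have := hst e₀ (Fin.snoc μ 0) ⟨i.castSucc, by simpa using hi⟩ (by
          intro j
          refine Fin.lastCases (by simp) (fun j => by simpa using hμ j) j)
        simpa [Fin.sum_univ_castSucc] using this)
    rw [List.ofFn_succ', List.concat_eq_append, isWeaklyRegular_append_iff,
      isWeaklyRegular_singleton_iff]
    refine ⟨h1, ?_⟩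
    by_contra hreg
    set J := Ideal.ofList (List.ofFn fun i : Fin n => g i.castSucc) with hJ
    have hmem : g (Fin.last n) ∈ {r : R | IsSMulRegular (R ⧸ (J • ⊤ : Submodule R R)) r}ᶜ := hreg
    rw [← biUnion_associatedPrimes_eq_compl_regular] at hmem
    simp only [Set.mem_iUnion] at hmem
    obtain ⟨P, hP, hgP⟩ := hmem
    obtain ⟨hprime, x, hx⟩ := (isAssociatedPrime_iff).1 hP
    obtain ⟨u, rfl⟩ := Submodule.Quotient.mk_surjective _ x
    have hu : ∀ x, x * u ∈ J ↔ x ∈ P := by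
      intro x
      rw [hx, Submodule.mem_colon_singleton, ← Submodule.Quotient.mk_smul, Submodule.mem_bot,
        Submodule.Quotient.mk_eq_zero, smul_eq_mul, smul_eq_mul, Ideal.mul_top]
    refine not_isStrongFamily_of_associatedPrime hn g e hg he P ?_ _ (by simp) h1 hu hst
    refine Fin.lastCases hgP fun i => ?_
    refine (hu _).1 (Ideal.mul_mem_right _ _ (Ideal.subset_span ?_))
    exact (List.mem_ofFn' _ _).2 ⟨i, rfl⟩
end StrongFamily

section Refinement

variable {K σ : Type*} [Field K]

/-- A finite set of forms with positive degrees at most `d`; each form is stored with its degree. -/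
def MvPolynomial.IsFormSet (d : ℕ) (S : Finset (ℕ × MvPolynomial σ K)) : Prop :=
  ∀ x ∈ S, 0 < x.1 ∧ x.1 ≤ d ∧ x.2.IsHomogeneous x.1

/-- `s`-strength of the degree `e` part of a finite set of forms. -/
def MvPolynomial.IsStrongAt (s : ℕ) (S : Finset (ℕ × MvPolynomial σ K)) (e : ℕ) : Prop :=
  ∀ μ : ℕ × MvPolynomial σ K → K, (∃ x ∈ S, μ x ≠ 0) → (∀ x ∈ S, μ x ≠ 0 → x.1 = e) →
    ¬ HasLowStrength e (s * (e - 1)) (∑ x ∈ S, μ x • x.2)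

/-- `S'` is a set of forms which is strong in degrees at most `j`, agrees with `S` in degrees
greater than `j`, and whose algebra contains `S`. -/
structure MvPolynomial.IsStrongRefinement (d j : ℕ) (S S' : Finset (ℕ × MvPolynomial σ K)) :
    Prop where
  isFormSet : IsFormSet d S'
  mem_adjoin : ∀ x ∈ S, x.2 ∈ Algebra.adjoin K (Prod.snd '' (S' : Set (ℕ × MvPolynomial σ K)))
  mem_iff : ∀ x : ℕ × MvPolynomial σ K, j < x.1 → (x ∈ S' ↔ x ∈ S)
  isStrongAt : ∀ e ≤ j, IsStrongAt S'.card S' e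

theorem MvPolynomial.IsFormSet.exists_of_not_isStrongAt {d j : ℕ}
    {S : Finset (ℕ × MvPolynomial σ K)} (hS : IsFormSet d S) (h : ¬ IsStrongAt S.card S (j + 1)) :
    ∃ x ∈ S, x.1 = j + 1 ∧ ∃ S' : Finset (ℕ × MvPolynomial σ K), IsFormSet d S' ∧
      S'.card ≤ (2 * j + 1) * S.card ∧
      (∀ y ∈ S, y.2 ∈ Algebra.adjoin K (Prod.snd '' (S' : Set (ℕ × MvPolynomial σ K)))) ∧
      (∀ y : ℕ × MvPolynomial σ K, j < y.1 → (y ∈ S' ↔ y ∈ S ∧ y ≠ x)) := by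
  classical
  simp only [IsStrongAt, not_forall, not_not] at h
  obtain ⟨μ, ⟨x, hxS, hμx⟩, hμ, r, p, q, a, b, hr, hab, hsum⟩ := h
  have hx := hμ x hxS hμx
  refine ⟨x, hxS, hx, S.erase x ∪ (Finset.univ.image (fun t => (p t, a t)) ∪
    Finset.univ.image (fun t => (q t, b t))), ?_, ?_, ?_, ?_⟩
  · intro y hy
    have hd := (hS x hxS).2.1
    simp only [Finset.mem_union, Finset.mem_erase, Finset.mem_image, Finset.mem_univ,
      true_and] at hy
    rcases hy with hy | ⟨t, rfl⟩ | ⟨t, rfl⟩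
    · exact hS y hy.2
    · obtain ⟨h1, h2, h3, h4, h5⟩ := hab t
      exact ⟨h1, by simp only; omega, h4⟩
    · obtain ⟨h1, h2, h3, h4, h5⟩ := hab t
      exact ⟨h2, by simp only; omega, h5⟩
  · have h1 : (Finset.univ.image (fun t => (p t, a t))).card ≤ r :=
      Finset.card_image_le.trans (by simp)
    have h2 : (Finset.univ.image (fun t => (q t, b t))).card ≤ r :=
      Finset.card_image_le.trans (by simp)
    have h3 := Finset.card_erase_le (s := S) (a := x)
    refine (Finset.card_union_le _ _).trans ?_
    have h4 := Finset.card_union_le (Finset.univ.image (fun t => (p t, a t)))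
      (Finset.univ.image (fun t => (q t, b t)))
    rw [Nat.add_sub_cancel] at hr
    nlinarith
  · set A := Algebra.adjoin K (Prod.snd '' ((S.erase x ∪ (Finset.univ.image (fun t => (p t, a t)) ∪
      Finset.univ.image (fun t => (q t, b t))) : Finset (ℕ × MvPolynomial σ K)) :
        Set (ℕ × MvPolynomial σ K)))
    have h1 : ∀ y ∈ S, y ≠ x → y.2 ∈ A := fun y hy hyx =>
      Algebra.subset_adjoin ⟨y, by simp [hy, hyx], rfl⟩
    have ha : ∀ t, a t ∈ A := fun t => Algebra.subset_adjoin ⟨(p t, a t), Finset.mem_coe.2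
      (Finset.mem_union_right _ (Finset.mem_union_left _ (Finset.mem_image.2 ⟨t, by simp⟩))), rfl⟩
    have hb : ∀ t, b t ∈ A := fun t => Algebra.subset_adjoin ⟨(q t, b t), Finset.mem_coe.2
      (Finset.mem_union_right _ (Finset.mem_union_right _ (Finset.mem_image.2 ⟨t, by simp⟩))), rfl⟩
    intro y hy
    by_cases hyx : y = x
    · subst hyx
      have h2 : μ y • y.2 ∈ A := by
        rw [← Finset.add_sum_erase S _ hy] at hsum
        rw [eq_sub_of_add_eq hsum]
        refine sub_mem (sum_mem fun t _ => mul_mem (ha t) (hb t)) (sum_mem fun z hz => ?_)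
        rw [Finset.mem_erase] at hz
        exact A.smul_mem (h1 z hz.2 hz.1) _
      have := A.smul_mem h2 (μ y)⁻¹
      rwa [smul_smul, inv_mul_cancel₀ hμx, one_smul] at this
    · exact h1 y hy hyx
  · intro y hy
    simp only [Finset.mem_union, Finset.mem_erase, Finset.mem_image, Finset.mem_univ,
      true_and]
    constructor
    · rintro (h | ⟨t, rfl⟩ | ⟨t, rfl⟩)
      · exact h.symm
      · have := hab t
        simp only at hy
        omega
      · have := hab t
        simp only at hy
        omega
    · exact fun h => Or.inl h.symm

theorem MvPolynomial.IsStrongRefinement.exists_succ {d j C : ℕ} (hC : 2 * j + 1 ≤ C) {f : ℕ → ℕ}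
    (hf : ∀ n, n ≤ f n)
    (h : ∀ n ≥ 3, ∀ S : Finset (ℕ × MvPolynomial σ K), IsFormSet d S → S.card ≤ C * n →
      ∃ S', IsStrongRefinement d j S S' ∧ S'.card ≤ f n) (m : ℕ) :
    ∀ n ≥ 3, ∀ S : Finset (ℕ × MvPolynomial σ K), IsFormSet d S → S.card ≤ C * n →
      (S.filter fun x => x.1 = j + 1).card ≤ m →
      ∃ S', IsStrongRefinement d (j + 1) S S' ∧ S'.card ≤ f^[m + 1] n := by
  classical
  induction m with
  | zero =>
    intro n hn S hS hcard hm
    obtain ⟨S', hS', hc⟩ := h n hn S hS hcard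
    refine ⟨S', ⟨hS'.1, hS'.2, fun x hx => hS'.3 x (by omega), fun e he => ?_⟩, hc⟩
    rcases he.lt_or_eq with he | rfl
    · exact hS'.4 e (by omega)
    · rintro μ ⟨x, hx, hμx⟩ hμ
      have hx1 := hμ x hx hμx
      rw [Nat.le_zero, Finset.card_eq_zero, Finset.filter_eq_empty_iff] at hm
      exact absurd hx1 (hm ((hS'.3 x (by omega)).1 hx))
  | succ m ih =>
    intro n hn S hS hcard hm
    obtain ⟨S₁, hS₁, hc₁⟩ := h n hn S hS hcard
    by_cases hst : IsStrongAt S₁.card S₁ (j + 1)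
    · refine ⟨S₁, ⟨hS₁.1, hS₁.2, fun x hx => hS₁.3 x (by omega), fun e he => ?_⟩,
        hc₁.trans ?_⟩
      · rcases he.lt_or_eq with he | rfl
        · exact hS₁.4 e (by omega)
        · exact hst
      · rw [Function.iterate_succ_apply]
        exact Function.id_le_iterate_of_id_le hf _ _
    · obtain ⟨x, hx, hxj, S₂, hS₂, hc₂, hadj, hmem⟩ := hS₁.1.exists_of_not_isStrongAt hst
      obtain ⟨S₃, hS₃, hc₃⟩ := ih (f n) (hn.trans (hf n)) S₂ hS₂
        (hc₂.trans (Nat.mul_le_mul hC hc₁)) (by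
          have : S₂.filter (fun x => x.1 = j + 1) ⊂ S.filter (fun x => x.1 = j + 1) := by
            rw [Finset.ssubset_iff_of_subset]
            · exact ⟨x, by simp [hxj, (hS₁.3 x (by omega)).1 hx], fun h => by
                rw [Finset.mem_filter, hmem x (by omega)] at h
                exact h.1.2 rfl⟩
            · intro y hy
              rw [Finset.mem_filter] at hy ⊢
              exact ⟨(hS₁.3 y (by omega)).1 ((hmem y (by omega)).1 hy.1).1, hy.2⟩
          have := Finset.card_lt_card this
          omega)
      refine ⟨S₃, ⟨hS₃.1, fun y hy => ?_, fun y hy => ?_, hS₃.4⟩, hc₃⟩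
      · refine Algebra.adjoin_le ?_ (hS₁.2 y hy)
        rintro _ ⟨z, hz, rfl⟩
        refine Algebra.adjoin_le ?_ (hadj z hz)
        rintro _ ⟨w, hw, rfl⟩
        exact hS₃.2 w hw
      · rw [hS₃.3 y hy, hmem y (by omega), hS₁.3 y (by omega)]
        refine and_iff_left_of_imp ?_
        rintro _ rfl
        omega
end Refinement

section Knuth

theorem knuth_one (a b : ℕ) : knuth a 1 b = a ^ b := by rw [knuth]

theorem knuth_right_one (a k : ℕ) : knuth a k 1 = a := by
  match k with
  | 0 => rw [knuth, pow_one]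
  | 1 => rw [knuth, pow_one]
  | k + 2 => rw [knuth]

theorem knuth_succ_succ (a k b : ℕ) :
    knuth a (k + 2) (b + 1) = knuth a (k + 1) (knuth a (k + 2) b) := by
  cases b with
  | zero => rw [zero_add, knuth_right_one, knuth.eq_3, knuth_right_one]
  | succ b => rw [knuth]

theorem knuth_strictMono_and_lt {a : ℕ} (ha : 2 ≤ a) (k : ℕ) :
    StrictMono (knuth a (k + 1)) ∧ ∀ b, b < knuth a (k + 1) b := by
  induction k with
  | zero =>
    have h : knuth a (0 + 1) = fun b => a ^ b := funext (knuth_one a)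
    rw [h]
    exact ⟨pow_right_strictMono₀ (by omega), fun b => Nat.lt_pow_self (by omega)⟩
  | succ k ih =>
    have h : StrictMono (knuth a (k + 1 + 1)) :=
      strictMono_nat_of_lt_succ fun b => by
        rw [knuth_succ_succ]
        exact ih.2 _
    refine ⟨h, fun b => ?_⟩
    induction b with
    | zero => rw [knuth.eq_3]; exact one_pos
    | succ b hb => exact lt_of_le_of_lt hb (h (Nat.lt_succ_self b))

theorem knuth_strictMono {a : ℕ} (ha : 2 ≤ a) (k : ℕ) : StrictMono (knuth a (k + 1)) :=
  (knuth_strictMono_and_lt ha k).1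

theorem lt_knuth {a : ℕ} (ha : 2 ≤ a) (k b : ℕ) : b < knuth a (k + 1) b :=
  (knuth_strictMono_and_lt ha k).2 b

theorem knuth_le_succ {a : ℕ} (ha : 2 ≤ a) (k b : ℕ) :
    knuth a (k + 1) b ≤ knuth a (k + 2) b := by
  cases b with
  | zero =>
    rw [knuth.eq_3]
    cases k with
    | zero => rw [knuth_one, pow_zero]
    | succ k => rw [knuth.eq_3]
  | succ b =>
    rw [knuth_succ_succ]
    exact (knuth_strictMono ha k).monotone (lt_knuth ha (k + 1) b)

theorem knuth_mono_left {a : ℕ} (ha : 2 ≤ a) {k l : ℕ} (hk : 1 ≤ k) (hkl : k ≤ l) (b : ℕ) :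
    knuth a k b ≤ knuth a l b := by
  induction l, hkl using Nat.le_induction with
  | base => rfl
  | succ l hl ih =>
    obtain ⟨l, rfl⟩ : ∃ m, l = m + 1 := ⟨l - 1, by omega⟩
    exact ih.trans (knuth_le_succ ha l b)

theorem knuth_iterate (a k m b : ℕ) :
    (knuth a (k + 1))^[m] (knuth a (k + 2) b) = knuth a (k + 2) (b + m) := by
  induction m with
  | zero => rfl
  | succ m ih => rw [Function.iterate_succ_apply', ih, ← add_assoc, knuth_succ_succ]

theorem mul_add_one_le_knuth_two {a : ℕ} (ha : 3 ≤ a) (m : ℕ) :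
    (2 * a - 2) * (m + 3) + 1 ≤ knuth a 2 (m + 2) := by
  obtain ⟨c, rfl⟩ : ∃ c, a = c + 3 := ⟨a - 3, by omega⟩
  have h2 : 2 * (c + 3) - 2 = 2 * c + 4 := by omega
  rw [h2]
  induction m with
  | zero =>
    rw [zero_add, knuth_succ_succ, knuth_right_one, knuth_one]
    calc (2 * c + 4) * (0 + 3) + 1 ≤ (c + 3) ^ 3 := by nlinarith [Nat.zero_le (c ^ 3)]
      _ ≤ (c + 3) ^ (c + 3) := Nat.pow_le_pow_right (by omega) (by omega)
  | succ m ih =>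
    rw [show m + 1 + 2 = m + 2 + 1 by ring, knuth_succ_succ, knuth_one]
    set x := knuth (c + 3) 2 (m + 2)
    obtain ⟨y, hy⟩ : ∃ y, x = y + 1 := ⟨x - 1, by omega⟩
    have h1 : y < (c + 3) ^ y := Nat.lt_pow_self (by omega)
    rw [hy] at ih ⊢
    rw [pow_succ]
    nlinarith [Nat.zero_le ((c + 3) ^ y * c), Nat.zero_le (c * m)]

theorem mul_le_pow_of_three_le {a n : ℕ} (ha : 3 ≤ a) (hn : 3 ≤ n) : (2 * a - 3) * n ≤ a ^ n := by
  obtain ⟨c, rfl⟩ : ∃ c, a = c + 3 := ⟨a - 3, by omega⟩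
  have h2 : 2 * (c + 3) - 3 = 2 * c + 3 := by omega
  rw [h2]
  induction n, hn using Nat.le_induction with
  | base => nlinarith [Nat.zero_le (c ^ 3)]
  | succ n hn ih =>
    rw [pow_succ]
    nlinarith [Nat.zero_le ((c + 3) ^ n * c)]

theorem iterate_knuth_le {a C n : ℕ} (ha : 3 ≤ a) (hC : C ≤ 2 * a - 3) (hn : 3 ≤ n) (k : ℕ) :
    (knuth a (k + 1))^[C * n + 1] n ≤ knuth a (k + 3) n := by
  have ha2 : 2 ≤ a := by omega
  calc (knuth a (k + 1))^[C * n + 1] n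
      ≤ (knuth a (k + 1))^[C * n + 1] (knuth a (k + 2) n) :=
        (knuth_strictMono ha2 k).monotone.iterate _ (lt_knuth ha2 (k + 1) n).le
    _ = knuth a (k + 2) (n + (C * n + 1)) := knuth_iterate ..
    _ ≤ knuth a (k + 2) (knuth a (k + 3) (n - 1)) := by
        refine (knuth_strictMono ha2 (k + 1)).monotone ?_
        obtain ⟨m, rfl⟩ : ∃ m, n = m + 3 := ⟨n - 3, by omega⟩
        refine le_trans ?_ ((mul_add_one_le_knuth_two ha m).trans
          (knuth_mono_left ha2 (by omega) (by omega) _))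
        have : C + 1 ≤ 2 * a - 2 := by omega
        calc m + 3 + (C * (m + 3) + 1) = (C + 1) * (m + 3) + 1 := by ring
          _ ≤ _ := by gcongr
    _ = knuth a (k + 3) n := by
        obtain ⟨m, rfl⟩ : ∃ m, n = m + 1 := ⟨n - 1, by omega⟩
        rw [knuth_succ_succ, Nat.add_sub_cancel]
end Knuth

section StrongRefinement
variable {K σ : Type*} [Field K]

theorem MvPolynomial.exists_isStrongRefinement {d : ℕ} (hd : 2 ≤ d) (j : ℕ) (hj : j < d) :
    ∀ n ≥ 3, ∀ S : Finset (ℕ × MvPolynomial σ K), IsFormSet d S → S.card ≤ (2 * d - 1) * n →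
      ∃ S', IsStrongRefinement d (j + 1) S S' ∧ S'.card ≤ knuth (d + 1) (2 * j + 1) n := by
  induction j with
  | zero =>
    intro n hn S hS hcard
    have hCn : 3 ≤ (2 * d - 1) * n := hn.trans (Nat.le_mul_of_pos_left _ (by omega))
    obtain ⟨S', hS', hc⟩ := IsStrongRefinement.exists_succ (d := d) (j := 0) (C := 1) le_rfl
      (f := id) (fun _ => le_rfl) (fun n hn S hS hc => ⟨S, ⟨hS, fun x hx =>
        Algebra.subset_adjoin ⟨x, hx, rfl⟩, fun _ _ => Iff.rfl, fun e he μ => by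
          rintro ⟨x, hx, hμx⟩ hμ
          have := hμ x hx hμx
          have := (hS x hx).1
          omega⟩, by simpa using hc⟩) _ _ hCn S hS (by rwa [one_mul]) le_rfl
    refine ⟨S', hS', ?_⟩
    rw [Function.iterate_id, id] at hc
    rw [mul_zero, zero_add, knuth_one]
    refine hc.trans (le_trans ?_ (mul_le_pow_of_three_le (by omega) hn))
    exact Nat.mul_le_mul_right _ (by omega)
  | succ j ih =>
    intro n hn S hS hcard
    obtain ⟨S', hS', hc⟩ := IsStrongRefinement.exists_succ (by omega)
      (fun n => (lt_knuth (by omega) (2 * j) n).le) (ih (by omega)) ((2 * d - 1) * n) n hn S hS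
      hcard ((Finset.card_filter_le _ _).trans hcard)
    exact ⟨S', hS', hc.trans (iterate_knuth_le (by omega) (by omega) hn (2 * j))⟩

end StrongRefinement

section Flat
open RingTheory.Sequence
open scoped Pointwise

theorem MvPolynomial.aeval_eq_eval₂_finSuccEquiv {K R : Type*} [CommRing K] [CommRing R]
    [Algebra K R] {n : ℕ} (g : Fin (n + 1) → R) (p : MvPolynomial (Fin (n + 1)) K) :
    aeval g p = (finSuccEquiv K n p).eval₂
      (aeval (fun i => g i.succ) : MvPolynomial (Fin n) K →ₐ[K] R).toRingHom (g 0) := by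
  induction p using MvPolynomial.induction_on with
  | C a => simp [finSuccEquiv_apply]
  | add p q hp hq => simp [hp, hq, Polynomial.eval₂_add]
  | mul_X p i hp =>
    rw [map_mul, map_mul, Polynomial.eval₂_mul, ← hp, aeval_X]
    congr 1
    refine Fin.cases ?_ (fun i => ?_) i
    · simp [finSuccEquiv_X_zero]
    · simp [finSuccEquiv_X_succ]

theorem RingTheory.Sequence.IsWeaklyRegular.eq_zero_of_sum_aeval_smul_eq_zero {K R ι : Type*}
    [CommRing K] [CommRing R] [Algebra K R] (s : Finset ι) (n : ℕ) :
    ∀ (M : Type*) [AddCommGroup M] [Module R M] [Module K M] [IsScalarTower K R M]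
      (g : Fin n → R) (b : ι → M), IsWeaklyRegular M (List.ofFn g) →
      (∀ c : ι → K, ∑ i ∈ s, c i • b i ∈ (Ideal.ofList (List.ofFn g) • ⊤ : Submodule R M) →
        ∀ i ∈ s, c i = 0) →
      ∀ φ : ι → MvPolynomial (Fin n) K, ∑ i ∈ s, aeval g (φ i) • b i = 0 →
        ∀ i ∈ s, φ i = 0 := by
  induction n with
  | zero =>
    intro M _ _ _ _ g b _ hb φ hφ i hi
    rw [eq_C_of_isEmpty (φ i), hb (fun i => coeff 0 (φ i)) ?_ i hi, C_0]
    have : ∑ i ∈ s, coeff 0 (φ i) • b i = 0 := by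
      rw [← hφ]
      refine Finset.sum_congr rfl fun i _ => ?_
      conv_rhs => rw [eq_C_of_isEmpty (φ i), algHom_C, algebraMap_smul]
    rw [this]
    exact zero_mem _
  | succ n ih =>
    intro M _ _ _ _ g b hg hb
    rw [List.ofFn_succ, isWeaklyRegular_cons_iff] at hg
    rw [List.ofFn_succ, Ideal.ofList_cons] at hb
    set J := Ideal.ofList (List.ofFn fun i : Fin n => g i.succ) with hJ
    let mk := (g 0 • (⊤ : Submodule R M)).mkQ
    let ev : Polynomial (MvPolynomial (Fin n) K) → R := Polynomial.eval₂
      (aeval (fun i => g i.succ) : MvPolynomial (Fin n) K →ₐ[K] R).toRingHom (g 0)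
    have hsingle : g 0 • (⊤ : Submodule R M) ≤ (Ideal.span {g 0} ⊔ J) • ⊤ := by
      rw [← Submodule.ideal_span_singleton_smul]
      exact Submodule.smul_mono_left le_sup_left
    have key := ih (QuotSMulTop (g 0) M) (fun i => g i.succ) (fun i => mk (b i)) hg.2 (by
      intro c hc
      refine hb c ?_
      have h1 : ∑ i ∈ s, c i • mk (b i) = mk (∑ i ∈ s, c i • b i) := by
        rw [map_sum]; rfl
      have h2 : (J • ⊤ : Submodule R (QuotSMulTop (g 0) M)) = (J • ⊤ : Submodule R M).map mk := by
        rw [Submodule.map_smul'', Submodule.map_top, Submodule.range_mkQ]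
      rw [h1, ← hJ, h2] at hc
      obtain ⟨y, hy, hy'⟩ := hc
      have h3 := (Submodule.Quotient.eq _).1 hy'
      have h4 := hsingle h3
      rw [← sub_sub_cancel y (∑ i ∈ s, c i • b i)]
      exact sub_mem (Submodule.smul_mono_left le_sup_right hy) h4)
    have hstep : ∀ Φ : ι → Polynomial (MvPolynomial (Fin n) K), ∑ i ∈ s, ev (Φ i) • b i = 0 →
        (∀ i ∈ s, (Φ i).coeff 0 = 0) ∧ ∑ i ∈ s, ev (Φ i).divX • b i = 0 := by
      intro Φ hΦ
      have hev : ∀ p, ev p = ev p.divX * g 0 + aeval (fun i => g i.succ) (p.coeff 0) := by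
        intro p
        conv_lhs => rw [← Polynomial.divX_mul_X_add p]
        simp [ev, Polynomial.eval₂_add]
      have h0 : ∀ i ∈ s, (Φ i).coeff 0 = 0 := by
        refine key _ ?_
        have := congr(mk $hΦ)
        rw [map_zero, map_sum] at this
        rw [← this]
        refine Finset.sum_congr rfl fun i _ => ?_
        rw [hev, add_smul, map_add, map_smul, map_smul, right_eq_add, ← map_smul]
        refine (Submodule.Quotient.mk_eq_zero _).2 ?_
        rw [mul_comm, mul_smul]
        exact Submodule.smul_mem_pointwise_smul _ _ _ trivial
      refine ⟨h0, hg.1 ?_⟩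
      change g 0 • _ = g 0 • (0 : M)
      rw [smul_zero, ← hΦ, Finset.smul_sum]
      refine Finset.sum_congr rfl fun i hi => ?_
      rw [hev (Φ i), h0 i hi, map_zero, add_zero, mul_comm, mul_smul]
    intro φ hφ i hi
    have hall : ∀ k : ℕ, ∀ Φ : ι → Polynomial (MvPolynomial (Fin n) K),
        ∑ i ∈ s, ev (Φ i) • b i = 0 → (Φ i).coeff k = 0 := by
      intro k
      induction k with
      | zero => exact fun Φ hΦ => (hstep Φ hΦ).1 i hi
      | succ k ihk =>
        intro Φ hΦ
        rw [← Polynomial.coeff_divX]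
        exact ihk (fun i => (Φ i).divX) (hstep Φ hΦ).2
    refine (finSuccEquiv K n).injective ?_
    rw [map_zero]
    ext1 k
    rw [Polynomial.coeff_zero]
    refine hall k (fun i => finSuccEquiv K n (φ i)) ?_
    rw [← hφ]
    exact Finset.sum_congr rfl fun i _ => by rw [aeval_eq_eval₂_finSuccEquiv]

theorem MvPolynomial.homogeneousComponent_mul_eq_zero {σ A : Type*} [CommRing A] {m k : ℕ}
    (c : MvPolynomial σ A) {g : MvPolynomial σ A} (hg : g.IsHomogeneous k) (hmk : m < k) :
    homogeneousComponent m (c * g) = 0 := by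
  classical
  ext d
  rw [coeff_homogeneousComponent, coeff_zero]
  split_ifs with hd
  · rw [coeff_mul]
    refine Finset.sum_eq_zero fun x hx => ?_
    rw [hg.coeff_eq_zero, mul_zero]
    have := congr(Finsupp.degree $(Finset.HasAntidiagonal.mem_antidiagonal.1 hx))
    rw [map_add] at this
    omega
  · rfl

theorem MvPolynomial.flat_aeval_of_isWeaklyRegular {K σ : Type*} [Field K] {n : ℕ}
    (g : Fin n → MvPolynomial σ K) (e : Fin n → ℕ) (hg : ∀ i, (g i).IsHomogeneous (e i))
    (he : ∀ i, 0 < e i) (hreg : IsWeaklyRegular (MvPolynomial σ K) (List.ofFn g)) :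
    (aeval g : MvPolynomial (Fin n) K →ₐ[K] MvPolynomial σ K).toRingHom.Flat := by
  classical
  let A := MvPolynomial (Fin n) K
  let R := MvPolynomial σ K
  let J := Ideal.ofList (List.ofFn g)
  have hJ : J = Ideal.span (Set.range g) := by
    change Ideal.span _ = _
    congr 1
    ext x
    exact List.mem_ofFn' _ _
  let mk : R →ₗ[K] R ⧸ J := (Ideal.Quotient.mkₐ K J).toLinearMap
  have hmk : Function.Surjective mk := Ideal.Quotient.mk_surjective
  obtain ⟨κ, a, -, hspan, hli⟩ := exists_linearIndependent' K
    fun m : σ →₀ ℕ => mk (monomial m 1)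
  let b : κ → R := fun k => monomial (a k) 1
  let : Algebra A R := (aeval g : A →ₐ[K] R).toRingHom.toAlgebra
  have hsmul : ∀ (p : A) (x : R), p • x = aeval g p * x := fun p x => rfl
  have : IsScalarTower K A R := IsScalarTower.of_algebraMap_eq fun x =>
    ((aeval g : A →ₐ[K] R).commutes x).symm
  have hcomp : ∀ y ∈ Submodule.span K (Set.range b), ∀ m,
      homogeneousComponent m y ∈ Submodule.span A (Set.range b) := by
    intro y hy m
    induction hy using Submodule.span_induction with
    | mem y h =>
      obtain ⟨k, rfl⟩ := h
      rw [homogeneousComponent_of_mem (isHomogeneous_monomial 1 rfl)]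
      split_ifs
      · exact Submodule.subset_span ⟨k, rfl⟩
      · exact zero_mem _
    | zero => rw [map_zero]; exact zero_mem _
    | add x y _ _ hx hy => rw [map_add]; exact add_mem hx hy
    | smul c x _ hx =>
      rw [map_smul, ← algebraMap_smul A]
      exact Submodule.smul_mem _ _ hx
  have hdec : ∀ f : R, ∃ y ∈ Submodule.span K (Set.range b), f - y ∈ J := by
    intro f
    have h1 : mk f ∈ Submodule.span K (Set.range fun m : σ →₀ ℕ => mk (monomial m 1)) := by
      rw [Set.range_comp' mk, ← Submodule.map_span]
      refine Submodule.mem_map_of_mem ?_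
      have := (basisMonomials σ K).span_eq
      simp only [coe_basisMonomials] at this
      rw [this]; trivial
    rw [← hspan, show Set.range (_ ∘ a) = mk '' Set.range b from Set.range_comp mk b,
      ← Submodule.map_span] at h1
    obtain ⟨y, hy, hyf⟩ := h1
    exact ⟨y, hy, Ideal.Quotient.eq.1 hyf.symm⟩
  have hhom : ∀ m (f : R), f.IsHomogeneous m → f ∈ Submodule.span A (Set.range b) := by
    intro m
    induction m using Nat.strong_induction_on with
    | _ m ih =>
      intro f hf
      obtain ⟨y, hy, hfy⟩ := hdec f
      rw [hJ] at hfy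
      obtain ⟨c, hc⟩ := (Ideal.mem_span_range_iff_exists_fun).1 hfy
      rw [← homogeneousComponent_eq_self hf, ← sub_add_cancel f y, map_add, ← hc, map_sum]
      refine add_mem (sum_mem fun i _ => ?_) (hcomp y hy m)
      by_cases him : e i ≤ m
      · rw [homogeneousComponent_mul_of_isHomogeneous _ (hg i) him]
        have := Submodule.smul_mem _ (X i : A) (ih (m - e i) (by have := he i; omega) _
          (homogeneousComponent_isHomogeneous (m - e i) (c i)))
        rwa [hsmul, aeval_X, mul_comm] at this
      · rw [homogeneousComponent_mul_eq_zero _ (hg i) (not_le.1 him)]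
        exact zero_mem _
  have htop : ⊤ ≤ Submodule.span A (Set.range b) := by
    intro f _
    rw [← sum_homogeneousComponent f]
    exact sum_mem fun m _ => hhom m _ (homogeneousComponent_isHomogeneous m f)
  have hind : LinearIndependent A b := by
    rw [linearIndependent_iff']
    intro s φ hφ
    refine hreg.eq_zero_of_sum_aeval_smul_eq_zero s n R g b ?_ φ hφ
    intro c hc
    rw [smul_eq_mul, Ideal.mul_top] at hc
    refine linearIndependent_iff'.1 hli s c ?_
    have : mk (∑ i ∈ s, c i • b i) = 0 := Ideal.Quotient.eq_zero_iff_mem.2 hc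
    rw [map_sum] at this
    simpa using this
  have := Module.Free.of_basis (Module.Basis.mk hind htop)
  exact (inferInstance : Module.Flat A R)
end Flat

section ProjDim
universe u
open TensorProduct CategoryTheory

/-- `Module.HasProjDimLE R n M` says that `M` has a projective resolution of length `n`. -/
inductive Module.HasProjDimLE (R : Type u) [CommRing R] :
    ℕ → ∀ (M : Type u) [AddCommGroup M] [Module R M], Prop
  | zero (M : Type u) [AddCommGroup M] [Module R M] (h : Module.Projective R M) :
      HasProjDimLE R 0 M
  | succ {n : ℕ} (M P Q : Type u) [AddCommGroup M] [Module R M] [AddCommGroup P] [Module R P]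
      [AddCommGroup Q] [Module R Q] (i : Q →ₗ[R] P) (p : P →ₗ[R] M) (hi : Function.Injective i)
      (hip : Function.Exact i p) (hp : Function.Surjective p) (hP : Module.Projective R P)
      (hQ : HasProjDimLE R n Q) : HasProjDimLE R (n + 1) M

namespace Module.HasProjDimLE

variable {R : Type u} [CommRing R] {n : ℕ} {M : Type u} [AddCommGroup M] [Module R M]

theorem of_equiv {M' : Type u} [AddCommGroup M'] [Module R M'] (h : HasProjDimLE R n M)
    (e : M ≃ₗ[R] M') : HasProjDimLE R n M' := by
  cases h with
  | zero _ h => exact .zero _ (.of_equiv e)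
  | succ _ P Q i p hi hip hp hP hQ =>
    refine .succ _ P Q i (e.toLinearMap ∘ₗ p) hi ?_ (e.surjective.comp hp) hP hQ
    intro x
    simp [← hip x]

theorem baseChange (S : Type u) [CommRing S] [Algebra R S] [Module.Flat R S]
    (h : HasProjDimLE R n M) : HasProjDimLE S n (S ⊗[R] M) := by
  induction h with
  | zero M h => exact .zero _ inferInstance
  | succ M P Q i p hi hip hp hP hQ ih =>
    exact .succ _ _ _ (i.baseChange S) (p.baseChange S)
      (Module.Flat.lTensor_preserves_injective_linearMap i hi) (Module.Flat.lTensor_exact S hip)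
      (LinearMap.lTensor_surjective S hp) inferInstance ih

theorem hasProjectiveDimensionLE (h : HasProjDimLE R n M) :
    HasProjectiveDimensionLE (ModuleCat.of R M) n := by
  induction h with
  | zero M h =>
    rw [← projective_iff_hasProjectiveDimensionLE_zero]
    exact (IsProjective.iff_projective M).1 h
  | succ M P Q i p hi hip hp hP hQ ih =>
    have hS := ModuleCat.shortComplex_shortExact
      (ModuleCat.shortComplexOfCompEqZero i p hip.linearMap_comp_eq_zero) hip hi hp
    have hP' : CategoryTheory.Projective (ModuleCat.of R P) := (IsProjective.iff_projective P).1 hP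
    exact hS.hasProjectiveDimensionLT_X₃ _ ih (hasProjectiveDimensionLT_of_ge _ 1 _ (by omega))

theorem of_hasProjectiveDimensionLE (n : ℕ) : ∀ (M : Type u) [AddCommGroup M] [Module R M],
    HasProjectiveDimensionLE (ModuleCat.of R M) n → HasProjDimLE R n M := by
  induction n with
  | zero =>
    intro M _ _ h
    rw [← projective_iff_hasProjectiveDimensionLE_zero] at h
    exact .zero _ ((IsProjective.iff_projective M).2 h)
  | succ n ih =>
    intro M _ _ h
    let p : (M →₀ R) →ₗ[R] M := Finsupp.linearCombination R id
    have hp : Function.Surjective p := Finsupp.linearCombination_id_surjective R M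
    have hS := LinearMap.shortExact_shortComplexKer hp
    have hP' : CategoryTheory.Projective (ModuleCat.of R (M →₀ R)) :=
      (IsProjective.iff_projective _).1 inferInstance
    exact .succ _ _ _ p.ker.subtype p p.ker.injective_subtype (LinearMap.exact_subtype_ker_map p) hp
      inferInstance (ih _ ((hS.hasProjectiveDimensionLT_X₃_iff n hP').1 h))

theorem mono {m : ℕ} (h : HasProjDimLE R n M) (hnm : n ≤ m) : HasProjDimLE R m M :=
  of_hasProjectiveDimensionLE m M
    (have := h.hasProjectiveDimensionLE; hasProjectiveDimensionLT_of_ge _ (n + 1) _ (by omega))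

end Module.HasProjDimLE

open scoped Polynomial in
theorem Module.HasProjDimLE.polynomial {R : Type u} [CommRing R] {n : ℕ} (M : Type u)
    [AddCommGroup M] [Module R M] [Module R[X] M] [IsScalarTower R R[X] M]
    (h : HasProjDimLE R n M) : HasProjDimLE R[X] (n + 1) M := by
  let xM : M →ₗ[R] M := (LinearMap.lsmul R[X] M Polynomial.X).restrictScalars R
  let φ : R[X] ⊗[R] M →ₗ[R[X]] R[X] ⊗[R] M :=
    LinearMap.lsmul R[X] _ Polynomial.X - xM.baseChange R[X]
  let p : R[X] ⊗[R] M →ₗ[R[X]] M := LinearMap.liftBaseChange R[X] (LinearMap.id : M →ₗ[R] M)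
  have hp1 : ∀ m, p (1 ⊗ₜ m) = m := fun m => by simp [p]
  have hφt : ∀ f m, φ (f ⊗ₜ m) = (Polynomial.X * f) ⊗ₜ m - f ⊗ₜ ((Polynomial.X : R[X]) • m) :=
    fun f m => by
    simp [φ, xM, smul_tmul']
  have hp : Function.Surjective p := fun m => ⟨_, hp1 m⟩
  have hpφ : ∀ z, p (φ z) = 0 := by
    intro z
    induction z with
    | zero => simp
    | add x y hx hy => rw [map_add, map_add, hx, hy, add_zero]
    | tmul f m => simp [hφt, p, mul_smul, smul_comm f]
  have hex : ∀ z, z - 1 ⊗ₜ p z ∈ LinearMap.range φ := by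
    intro z
    induction z with
    | zero => simp
    | add x y hx hy =>
      rw [map_add, tmul_add, add_sub_add_comm]
      exact add_mem hx hy
    | tmul f m =>
      induction f using Polynomial.induction_on' with
      | add f g hf hg =>
        rw [add_tmul, map_add, tmul_add, add_sub_add_comm]
        exact add_mem hf hg
      | monomial k a =>
        induction k generalizing m with
        | zero =>
          have : (Polynomial.monomial 0 a : R[X]) ⊗ₜ[R] m -
              1 ⊗ₜ p ((Polynomial.monomial 0 a : R[X]) ⊗ₜ[R] m) = 0 := by
            rw [sub_eq_zero, Polynomial.monomial_zero_left, ← Polynomial.algebraMap_eq,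
              Algebra.algebraMap_eq_smul_one,
              smul_tmul, hp1]
          rw [this]
          exact zero_mem _
        | succ k ih =>
          have h1 := add_mem (ih ((Polynomial.X : R[X]) • m))
            (LinearMap.mem_range_self φ (Polynomial.monomial k a ⊗ₜ m))
          rw [hφt, Polynomial.X_mul_monomial] at h1
          have h2 : p ((Polynomial.monomial k a : R[X]) ⊗ₜ[R] ((Polynomial.X : R[X]) • m)) =
              p ((Polynomial.monomial (k + 1) a : R[X]) ⊗ₜ[R] m) := by
            simp [p, ← Polynomial.X_mul_monomial, mul_smul, smul_comm (Polynomial.monomial k a)]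
          rw [h2] at h1
          convert h1 using 1
          abel
  let e := PolynomialModule.polynomialTensorProductLEquivPolynomialModule R M
  have he : ∀ f m k, (e (f ⊗ₜ m)).coeff k = f.coeff k • m := by
    intro f m k
    have : e (f ⊗ₜ m) = f • PolynomialModule.single R 0 m := by
      simp [e, PolynomialModule.polynomialTensorProductLEquivPolynomialModule]
      rfl
    rw [this, PolynomialModule.smul_single_apply]
    simp
  have hinj : Function.Injective φ := by
    rw [injective_iff_map_eq_zero]
    intro z hz
    have hc : ∀ z k, (e (φ z)).coeff (k + 1) =
        (e z).coeff k - (Polynomial.X : R[X]) • (e z).coeff (k + 1) := by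
      intro z k
      induction z with
      | zero => simp
      | add x y hx hy =>
        simp only [map_add, PolynomialModule.coeff_add, Finsupp.add_apply, hx, hy, smul_add]
        abel
      | tmul f m =>
        have h1 : e ((Polynomial.X * f) ⊗ₜ m) =
            e (φ (f ⊗ₜ m)) + e (f ⊗ₜ ((Polynomial.X : R[X]) • m)) := by
          rw [← map_add, hφt, sub_add_cancel]
        have h2 := congrArg (fun q => q.coeff (k + 1)) h1
        simp only [PolynomialModule.coeff_add, Finsupp.add_apply, he, Polynomial.coeff_X_mul] at h2
        rw [he, he, h2, smul_comm (Polynomial.X : R[X]), add_sub_cancel_right]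
    have hrec : ∀ k, (e z).coeff k = (Polynomial.X : R[X]) • (e z).coeff (k + 1) := fun k => by
      have := hc z k
      rwa [hz, map_zero, PolynomialModule.coeff_zero, Finsupp.zero_apply, eq_comm,
        sub_eq_zero] at this
    have hpow : ∀ j k, (e z).coeff k = (Polynomial.X ^ j : R[X]) • (e z).coeff (k + j) := by
      intro j
      induction j with
      | zero => simp
      | succ j ih =>
        intro k
        rw [ih, hrec, smul_smul, pow_succ, add_assoc]
    have h0 : ∀ k, (e z).coeff k = 0 := by
      intro k
      obtain ⟨b, hb⟩ := (e z).coeff.support.bddAbove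
      have : (e z).coeff (k + (b + 1)) = 0 := by
        by_contra h
        have := hb (Finsupp.mem_support_iff.2 h)
        omega
      rw [hpow (b + 1), this, smul_zero]
    exact e.injective (by
      rw [map_zero]
      exact PolynomialModule.coeff_injective (Finsupp.ext h0))
  have hS := ModuleCat.shortComplex_shortExact
    (ModuleCat.shortComplexOfCompEqZero φ p (LinearMap.ext hpφ)) (by
      intro z
      refine ⟨fun hz => ?_, fun ⟨w, hw⟩ => hw ▸ hpφ w⟩
      have := hex z
      change p z = 0 at hz
      rwa [hz, tmul_zero, sub_zero] at this) hinj hp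
  have hT := (h.baseChange R[X]).hasProjectiveDimensionLE
  exact .of_hasProjectiveDimensionLE _ _ (hS.hasProjectiveDimensionLT_X₃ _ hT
    (hasProjectiveDimensionLT_of_ge _ (n + 1) _ (by omega)))
end ProjDim

section Syzygy
universe u

theorem Module.HasProjDimLE.of_ringEquiv {R S : Type u} [CommRing R] [CommRing S] (σ : R ≃+* S)
    {n : ℕ} (M : Type u) [AddCommGroup M] [Module S M]
    (h : let := Module.compHom M σ.toRingHom; Module.HasProjDimLE R n M) :
    Module.HasProjDimLE S n M := by
  let := Module.compHom M σ.toRingHom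
  let := σ.toRingHom.toAlgebra
  have hf : Module.Flat R S := .of_linearEquiv (M := R)
    (LinearEquiv.symm { σ with map_smul' := fun r x => map_mul σ r x })
  have : IsScalarTower R S M := ⟨fun r s m => mul_smul (σ r) s m⟩
  refine (h.baseChange S).of_equiv (M' := M) (LinearEquiv.ofBijective
    (LinearMap.liftBaseChange S (LinearMap.id : M →ₗ[R] M)) ⟨?_, fun m => ⟨1 ⊗ₜ m, by simp⟩⟩)
  have : ∀ z : TensorProduct R S M, ∃ m : M, z = 1 ⊗ₜ m := by
    intro z
    induction z with
    | zero => exact ⟨0, by simp⟩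
    | add x y hx hy =>
      obtain ⟨a, rfl⟩ := hx
      obtain ⟨b, rfl⟩ := hy
      exact ⟨a + b, (TensorProduct.tmul_add _ _ _).symm⟩
    | tmul s m =>
      obtain ⟨r, rfl⟩ := σ.surjective s
      refine ⟨r • m, ?_⟩
      rw [← TensorProduct.smul_tmul]
      congr 1
      exact (mul_one _).symm
  rw [injective_iff_map_eq_zero]
  intro z hz
  obtain ⟨m, rfl⟩ := this z
  simp at hz
  simp [hz]

/-- The Hilbert syzygy theorem. -/
theorem MvPolynomial.hasProjDimLE (K : Type u) [Field K] (n : ℕ) :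
    ∀ (M : Type u) [AddCommGroup M] [Module (MvPolynomial (Fin n) K) M],
      Module.HasProjDimLE (MvPolynomial (Fin n) K) n M := by
  induction n with
  | zero =>
    intro M _ _
    have := (MvPolynomial.isEmptyRingEquiv K (Fin 0)).symm.isSemisimpleRing
    exact .zero M (Module.projective_of_isSemisimpleRing _ _)
  | succ n ih =>
    intro M _ _
    refine .of_ringEquiv (finSuccEquiv K n).symm.toRingEquiv M ?_
    let := Module.compHom M (finSuccEquiv K n).symm.toRingEquiv.toRingHom
    let : Module (MvPolynomial (Fin n) K) M := Module.compHom M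
      (Polynomial.C : MvPolynomial (Fin n) K →+* Polynomial (MvPolynomial (Fin n) K))
    have : IsScalarTower (MvPolynomial (Fin n) K) (Polynomial (MvPolynomial (Fin n) K)) M :=
      ⟨fun r s m => by
        rw [Polynomial.smul_eq_C_mul, mul_smul]
        rfl⟩
    exact .polynomial M (ih M)
end Syzygy

section Splice
universe u
open CategoryTheory CategoryTheory.Limits

variable {C : Type*} [Category* C] [Abelian C]

theorem ChainComplex.exists_projectiveResolution (c : ChainComplex C ℕ)
    (hc : ∀ n, Projective (c.X n)) {Z : C} (f : c.X 0 ⟶ Z) (hf : Epi f) (w : c.d 1 0 ≫ f = 0)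
    (h₀ : (ShortComplex.mk (c.d 1 0) f w).Exact)
    (h : ∀ n, (ShortComplex.mk _ _ (c.d_comp_d (n + 2) (n + 1) n)).Exact) :
    ∃ P : ProjectiveResolution Z, P.complex = c := by
  refine ⟨{ complex := c
            projective := hc
            hasHomology := inferInstance
            π := (ChainComplex.toSingle₀Equiv _ _).symm ⟨f, w⟩
            quasiIso := ⟨fun n => ?_⟩ }, rfl⟩
  cases n with
  | zero =>
    rw [ChainComplex.quasiIsoAt₀_iff, ShortComplex.quasiIso_iff_of_zeros']
    · refine (ShortComplex.exact_and_epi_g_iff_of_iso ?_).2 ⟨h₀, hf⟩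
      refine ShortComplex.isoMk (Iso.refl _) (Iso.refl _) (Iso.refl _) ?_ ?_
      · exact (Category.id_comp _).trans (Category.comp_id _).symm
      · refine (Category.id_comp _).trans (Eq.trans ?_ (Category.comp_id _).symm)
        exact (ChainComplex.toSingle₀Equiv_symm_apply_f_zero f w).symm
    all_goals first | rfl | exact c.shape _ _ (by simp)
  | succ n =>
    rw [quasiIsoAt_iff_exactAt']
    · exact ((HomologicalComplex.exactAt_iff' _ (n + 2) (n + 1) n
        (by simp only [ChainComplex.prev]; rfl) (by simp)).2 (h n))
    · exact ChainComplex.exactAt_succ_single_obj _ _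

theorem CategoryTheory.ShortComplex.ShortExact.exists_projectiveResolution
    {S : ShortComplex C} (hS : S.ShortExact) [Projective S.X₂] (Q : ProjectiveResolution S.X₁) :
    ∃ P : ProjectiveResolution S.X₃, ∀ i, P.complex.X (i + 1) = Q.complex.X i := by
  have := hS.mono_f
  have := hS.epi_g
  let ε : Q.complex.X 0 ⟶ S.X₁ := Q.π.f 0
  have hε : Q.complex.d 1 0 ≫ ε = 0 := Q.complex_d_comp_π_f_zero
  have hεe : Epi ε := inferInstanceAs (Epi (Q.π.f 0))
  have hε₀ : (ShortComplex.mk _ _ hε).Exact := Q.exact₀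
  have hw : Q.complex.d 1 0 ≫ ε ≫ S.f = 0 := by rw [reassoc_of% hε, zero_comp]
  have hw' : (ε ≫ S.f) ≫ S.g = 0 := by rw [Category.assoc, S.zero, comp_zero]
  have h₀ : (ShortComplex.mk _ _ hw').Exact :=
    (ShortComplex.exact_iff_of_epi_of_isIso_of_mono
      ({ τ₁ := ε, τ₂ := 𝟙 _, τ₃ := 𝟙 _ } : ShortComplex.mk _ _ hw' ⟶ S)).2 hS.exact
  have h₁ : (ShortComplex.mk _ _ hw).Exact :=
    (ShortComplex.exact_iff_of_epi_of_isIso_of_mono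
      ({ τ₁ := 𝟙 _, τ₂ := 𝟙 _, τ₃ := S.f } :
        ShortComplex.mk _ _ hε ⟶ ShortComplex.mk _ _ hw)).1 hε₀
  obtain ⟨P, hP⟩ := ChainComplex.exists_projectiveResolution
    (Q.complex.augment (ε ≫ S.f) hw)
    (by rintro (_ | n)
        · exact inferInstanceAs (Projective S.X₂)
        · exact Q.projective n) S.g this hw' h₀
    (by rintro (_ | n)
        · exact h₁
        · exact Q.exact_succ n)
  exact ⟨P, fun i => by rw [hP]; rfl⟩

theorem Module.HasProjDimLE.projDimLE {R : Type u} [CommRing R] {n : ℕ} {M : Type u}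
    [AddCommGroup M] [Module R M] (h : Module.HasProjDimLE R n M) : ProjDimLE R M n := by
  induction h with
  | zero M h =>
    have := (IsProjective.iff_projective M).1 h
    refine ⟨.self (ModuleCat.of R M), fun i hi => ?_⟩
    exact HomologicalComplex.isZero_single_obj_X _ _ _ _ hi.ne'
  | succ M P Q i p hi hip hp hP hQ ih =>
    have hS := ModuleCat.shortComplex_shortExact
      (ModuleCat.shortComplexOfCompEqZero i p hip.linearMap_comp_eq_zero) hip hi hp
    have hP' : CategoryTheory.Projective (ModuleCat.of R P) := (IsProjective.iff_projective P).1 hP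
    obtain ⟨A, hA⟩ := ih
    obtain ⟨B, hB⟩ := @ShortComplex.ShortExact.exists_projectiveResolution _ _ _ _ hS hP' A
    refine ⟨B, fun j hj => ?_⟩
    obtain ⟨j, rfl⟩ : ∃ k, j = k + 1 := ⟨j - 1, by omega⟩
    rw [hB]
    exact hA j (by omega)

end Splice

section Quotient
universe u

variable {K : Type u} [Field K] {N : ℕ}

theorem MvPolynomial.projDimLE_quotient_of_isWeaklyRegular {n : ℕ}
    (g : Fin n → MvPolynomial (Fin N) K) (e : Fin n → ℕ)
    (hg : ∀ i, (g i).IsHomogeneous (e i)) (he : ∀ i, 0 < e i)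
    (hreg : RingTheory.Sequence.IsWeaklyRegular (MvPolynomial (Fin N) K) (List.ofFn g))
    (s : Set (MvPolynomial (Fin N) K)) (hs : s ⊆ Algebra.adjoin K (Set.range g)) {m : ℕ}
    (hm : n ≤ m) :
    ProjDimLE (MvPolynomial (Fin N) K) (MvPolynomial (Fin N) K ⧸ Ideal.span s) m := by
  have hflat := flat_aeval_of_isWeaklyRegular g e hg he hreg
  let φ : MvPolynomial (Fin n) K →+* MvPolynomial (Fin N) K :=
    (aeval g : MvPolynomial (Fin n) K →ₐ[K] MvPolynomial (Fin N) K).toRingHom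
  let := φ.toAlgebra
  have : Module.Flat (MvPolynomial (Fin n) K) (MvPolynomial (Fin N) K) := hflat
  let J : Ideal (MvPolynomial (Fin n) K) := Ideal.span (φ ⁻¹' s)
  have hJ : J.map (algebraMap (MvPolynomial (Fin n) K) (MvPolynomial (Fin N) K)) =
      Ideal.span s := by
    rw [Ideal.map_span]
    congr 1
    refine Set.image_preimage_eq_of_subset fun x hx => ?_
    have := hs hx
    rw [Algebra.adjoin_range_eq_range_aeval] at this
    exact this
  rw [← hJ]
  exact ((((MvPolynomial.hasProjDimLE K n (MvPolynomial (Fin n) K ⧸ J)).baseChange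
    (MvPolynomial (Fin N) K)).of_equiv (Algebra.TensorProduct.quotIdealMapEquivTensorQuot
      (MvPolynomial (Fin N) K) J).symm.toLinearEquiv).mono hm).projDimLE

theorem MvPolynomial.IsStrongRefinement.projDimLE_quotient [IsAlgClosed K] {d j : ℕ}
    {S S' : Finset (ℕ × MvPolynomial (Fin N) K)} (h : IsStrongRefinement d j S S') (hj : d ≤ j)
    {m : ℕ} (hm : S'.card ≤ m) :
    ProjDimLE (MvPolynomial (Fin N) K)
      (MvPolynomial (Fin N) K ⧸ Ideal.span (Prod.snd '' (S : Set (ℕ × MvPolynomial (Fin N) K))))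
      m := by
  let q : Fin S'.card → ℕ × MvPolynomial (Fin N) K := fun i => S'.equivFin.symm i
  have hq : ∀ i, q i ∈ S' := fun i => (S'.equivFin.symm i).2
  have hqi : Function.Injective q := Subtype.val_injective.comp S'.equivFin.symm.injective
  have hqs : ∀ x ∈ S', ∃ i, q i = x := fun x hx => ⟨S'.equivFin ⟨x, hx⟩, by simp [q]⟩
  have hstrong : IsStrongFamily S'.card (fun i => (q i).2) (fun i => (q i).1) := by
    rintro e₀ μ ⟨i, hi⟩ hμ
    have hei : (q i).1 ≤ j := ((h.isFormSet _ (hq i)).2.1).trans hj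
    let μ' : ℕ × MvPolynomial (Fin N) K → K := Function.extend q μ 0
    have hμ' : ∀ i, μ' (q i) = μ i := fun i => hqi.extend_apply _ _ _
    have := h.isStrongAt e₀ (hμ i hi ▸ hei) μ' ⟨q i, hq i, by rwa [hμ']⟩ fun x hx hx' => by
      obtain ⟨i, rfl⟩ := hqs x hx
      exact hμ i (by rwa [← hμ'])
    rw [← Finset.sum_coe_sort S', ← S'.equivFin.symm.sum_comp] at this
    simpa only [← hμ'] using this
  refine projDimLE_quotient_of_isWeaklyRegular (fun i => (q i).2) (fun i => (q i).1)
    (fun i => (h.isFormSet _ (hq i)).2.2) (fun i => (h.isFormSet _ (hq i)).1)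
    (hstrong.isWeaklyRegular _ le_rfl _ _ (fun i => (h.isFormSet _ (hq i)).2.2)
      fun i => (h.isFormSet _ (hq i)).1) _ ?_ hm
  rintro _ ⟨x, hx, rfl⟩
  have hrange : Set.range (fun i => (q i).2) =
      Prod.snd '' (S' : Set (ℕ × MvPolynomial (Fin N) K)) := by
    ext y
    constructor
    · rintro ⟨i, rfl⟩
      exact ⟨q i, hq i, rfl⟩
    · rintro ⟨x, hx, rfl⟩
      obtain ⟨i, rfl⟩ := hqs x hx
      exact ⟨i, rfl⟩
  rw [hrange]
  exact h.mem_adjoin x hx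

theorem MvPolynomial.finiteDimensional_of_forall_isHomogeneous {σ : Type*} [Finite σ]
    {k : ℕ} (V : Submodule K (MvPolynomial σ K)) (hV : ∀ f ∈ V, f.IsHomogeneous k) :
    FiniteDimensional K V := by
  have : V ≤ restrictTotalDegree σ K k := fun f hf => by
    rw [mem_restrictTotalDegree]
    exact (hV f hf).totalDegree_le
  exact Submodule.finiteDimensional_of_le this

end Quotient

/-- Stillman bound: if `V = ⊕_{i=1}^d V_i` is a graded vector space of forms in
`R = K[x_1,…,x_N]` with dimension vector `δ`, `σ = max{2, δ_1, …, δ_d}`, and `I` is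
the ideal generated by `V`, then `pd_R(R/I) ≤ (d+1) ↑^(d²+d-2) ((d+1)^σ)`. -/
theorem stillman_projdim_bound {K : Type*} [Field K] [IsAlgClosed K] {N : ℕ}
    (d : ℕ) (hd : 2 ≤ d) (δ : Fin d → ℕ)
    (V : Fin d → Submodule K (MvPolynomial (Fin N) K))
    (hVhom : ∀ i : Fin d, ∀ f ∈ V i, f.IsHomogeneous ((i : ℕ) + 1))
    (hVdim : ∀ i : Fin d, Module.finrank K (V i) = δ i)
    (σ : ℕ) (hσ : σ = max 2 (Finset.univ.sup δ))
    (I : Ideal (MvPolynomial (Fin N) K))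
    (hI : I = Ideal.span (⋃ i : Fin d, (V i : Set (MvPolynomial (Fin N) K)))) :
    ProjDimLE (MvPolynomial (Fin N) K) (MvPolynomial (Fin N) K ⧸ I)
      (knuth (d + 1) (d ^ 2 + d - 2) ((d + 1) ^ σ)) := by
  classical
  have hfin : ∀ i, FiniteDimensional K (V i) := fun i =>
    finiteDimensional_of_forall_isHomogeneous (V i) (hVhom i)
  let b : ∀ i, Module.Basis (Fin (Module.finrank K (V i))) K (V i) := fun i =>
    Module.finBasis K (V i)
  let S : Finset (ℕ × MvPolynomial (Fin N) K) := Finset.univ.biUnion fun i : Fin d =>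
    Finset.univ.image fun t => ((i : ℕ) + 1, (b i t : MvPolynomial (Fin N) K))
  have hS : IsFormSet d S := by
    intro x hx
    simp only [S, Finset.mem_biUnion, Finset.mem_image, Finset.mem_univ, true_and] at hx
    obtain ⟨i, t, rfl⟩ := hx
    exact ⟨i.1.succ_pos, i.2, hVhom i _ (b i t).2⟩
  have hδσ : ∀ i, δ i ≤ σ := fun i =>
    hσ ▸ (Finset.le_sup (Finset.mem_univ i)).trans (le_max_right _ _)
  have hσ2 : 2 ≤ σ := hσ ▸ le_max_left _ _
  have h9 : 3 ≤ (d + 1) ^ σ := by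
    calc 3 ≤ (d + 1) ^ 1 := by rw [pow_one]; omega
      _ ≤ _ := Nat.pow_le_pow_right (by omega) (by omega)
  have hScard : S.card ≤ (2 * d - 1) * (d + 1) ^ σ := by
    calc S.card ≤ ∑ i : Fin d, δ i := Finset.card_biUnion_le.trans
          (Finset.sum_le_sum fun i _ => Finset.card_image_le.trans (by simp [hVdim]))
      _ ≤ d * σ := (Finset.sum_le_card_nsmul _ _ σ fun i _ => hδσ i).trans (by simp)
      _ ≤ (2 * d - 1) * (d + 1) ^ σ :=
        Nat.mul_le_mul (by omega) (Nat.lt_pow_self (by omega)).le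
  obtain ⟨S', hS', hcard⟩ := exists_isStrongRefinement hd (d - 1) (by omega) _ h9 S hS hScard
  have hIS : I = Ideal.span (Prod.snd '' (S : Set (ℕ × MvPolynomial (Fin N) K))) := by
    rw [hI]
    apply le_antisymm
    · rw [Ideal.span_le]
      intro f hf
      obtain ⟨i, hf⟩ := Set.mem_iUnion.1 hf
      have := congrArg Subtype.val ((b i).sum_repr ⟨f, hf⟩)
      simp only [AddSubmonoidClass.coe_finsetSum, SetLike.val_smul] at this
      rw [← this]
      refine sum_mem fun t _ => ?_
      rw [MvPolynomial.smul_eq_C_mul]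
      refine Ideal.mul_mem_left _ _ (Ideal.subset_span ⟨((i : ℕ) + 1, (b i t : _)), ?_, rfl⟩)
      simp only [S, Finset.coe_biUnion, Set.mem_iUnion]
      exact ⟨i, Finset.mem_coe.2 (Finset.mem_univ i), by simp⟩
    · refine Ideal.span_mono ?_
      rintro _ ⟨x, hx, rfl⟩
      simp only [S, Finset.mem_coe, Finset.mem_biUnion, Finset.mem_image, Finset.mem_univ,
        true_and] at hx
      obtain ⟨i, t, rfl⟩ := hx
      exact Set.mem_iUnion.2 ⟨i, (b i t).2⟩
  rw [hIS]
  refine hS'.projDimLE_quotient (by omega)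
    (hcard.trans (knuth_mono_left (by omega) (by omega) ?_ _))
  have : 2 * d ≤ d ^ 2 := by nlinarith
  omega
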